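/- Double smoothing estimate for the Duhamel term (estimate (est-nhsmooth)): there exists C>0 such that for every T>0 and every Schwartz function f on ℝ×ℝ³, sup_{x∈ℝ} ( ∫₀^T ∫_{ℝ²} | D² ∫₀^t U(t−t') f(t',·) dt' (x,y,z) |² dy dz dt )^{1/2} ≤ C ∫_ℝ ( ∫₀^T ∫_{ℝ²} |f(t,x,y,z)|² dy dz dt )^{1/2} dx, where D² is the Fourier multiplier operator with symbol |ξ̄|², i.e. D²g = 𝓕⁻¹(|ξ̄|² ĝ) = −Δg. -/

import Mathlib

open MeasureTheory Real Filter
open scoped ENNReal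

noncomputable section

/-- Euclidean dot product on ℝ³ (realized as ℝ × ℝ × ℝ). -/
def dot3 (a b : ℝ × ℝ × ℝ) : ℝ := a.1 * b.1 + a.2.1 * b.2.1 + a.2.2 * b.2.2

/-- Euclidean norm on ℝ³. -/
def en3 (ξ : ℝ × ℝ × ℝ) : ℝ := Real.sqrt (dot3 ξ ξ)

/-- The Zakharov–Kuznetsov dispersion relation ω(ξ,η,μ) = ξ(ξ²+η²+μ²). -/
def omega3 (ξ : ℝ × ℝ × ℝ) : ℝ := ξ.1 * (ξ.1 ^ 2 + ξ.2.1 ^ 2 + ξ.2.2 ^ 2)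

/-- Fourier transform on ℝ³, with normalization (2π)⁻³ ∫ e^{-i x·ξ} φ(x) dx. -/
def FT3 (φ : ℝ × ℝ × ℝ → ℂ) (ξ : ℝ × ℝ × ℝ) : ℂ :=
  ((((2 * π) ^ 3)⁻¹ : ℝ) : ℂ) * ∫ x : ℝ × ℝ × ℝ, Complex.exp (-Complex.I * (dot3 x ξ : ℂ)) * φ x

/-- Inverse Fourier transform on ℝ³: ∫ e^{i x·ξ} g(ξ) dξ. -/
def invFT3 (g : ℝ × ℝ × ℝ → ℂ) (x : ℝ × ℝ × ℝ) : ℂ :=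
  ∫ ξ : ℝ × ℝ × ℝ, Complex.exp (Complex.I * (dot3 x ξ : ℂ)) * g ξ

/-- The free Zakharov–Kuznetsov evolution U(t)φ(x̄) = ∫ e^{i(x̄·ξ̄ + tω(ξ̄))} φ̂(ξ̄) dξ̄. -/
def U3 (φ : ℝ × ℝ × ℝ → ℂ) (t : ℝ) (x : ℝ × ℝ × ℝ) : ℂ :=
  ∫ ξ : ℝ × ℝ × ℝ, Complex.exp (Complex.I * ((dot3 x ξ + t * omega3 ξ : ℝ) : ℂ)) * FT3 φ ξ

/-- L² norm on ℝ³. -/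
def L2norm3 (φ : ℝ × ℝ × ℝ → ℂ) : ℝ := Real.sqrt (∫ x : ℝ × ℝ × ℝ, ‖φ x‖ ^ 2)

/-- j-th coordinate of a point of ℝ³. -/
def coord3 (j : Fin 3) (ξ : ℝ × ℝ × ℝ) : ℝ := ![ξ.1, ξ.2.1, ξ.2.2] j

/-- Littlewood–Paley ring cutoff δ_k(ξ̄) = p(2^{-k-1}ξ̄) − p(2^{-k}ξ̄) on ℝ³. -/
def delta3 (p : ℝ × ℝ × ℝ → ℝ) (k : ℤ) (ξ : ℝ × ℝ × ℝ) : ℝ :=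
  p ((2:ℝ) ^ (-k-1) • ξ) - p ((2:ℝ) ^ (-k) • ξ)

/-- 1D rescaled cutoff p_k(ξ) = p(2^{-k}ξ). -/
def pk1 (p : ℝ → ℝ) (k : ℤ) (ξ : ℝ) : ℝ := p ((2:ℝ) ^ (-k) * ξ)

/-- 1D ring cutoff δ_k(ξ) = p(2^{-k-1}ξ) − p(2^{-k}ξ). -/
def dk1 (p : ℝ → ℝ) (k : ℤ) (ξ : ℝ) : ℝ := p ((2:ℝ) ^ (-k-1) * ξ) - p ((2:ℝ) ^ (-k) * ξ)

/-- Oscillatory integral I with three 1D symbols: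
I(t,x̄) = ∫ e^{i(x̄·ξ̄+tω(ξ̄))} ψ₁(ξ)ψ₂(η)ψ₃(μ) dξ̄. -/
def oscI (ψ₁ ψ₂ ψ₃ : ℝ → ℝ) (t : ℝ) (x : ℝ × ℝ × ℝ) : ℂ :=
  ∫ ξ : ℝ × ℝ × ℝ, Complex.exp (Complex.I * ((dot3 x ξ + t * omega3 ξ : ℝ) : ℂ)) *
    ((ψ₁ ξ.1 * ψ₂ ξ.2.1 * ψ₃ ξ.2.2 : ℝ) : ℂ)

/-- Duhamel term with a Fourier multiplier m applied:
∫₀^t (m(D) U(t-t') f(t',·))(x̄) dt', computed on the frequency side. -/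
def duhamel (m : ℝ × ℝ × ℝ → ℂ) (f : ℝ × (ℝ × ℝ × ℝ) → ℂ) (t : ℝ) (x : ℝ × ℝ × ℝ) : ℂ :=
  ∫ s in (0:ℝ)..t, ∫ ξ : ℝ × ℝ × ℝ,
    Complex.exp (Complex.I * ((dot3 x ξ + (t - s) * omega3 ξ : ℝ) : ℂ)) * m ξ *
      FT3 (fun w => f (s, w)) ξ

section FourierKernels

open scoped FourierTransform

/-- The unimodular exponential `e^{ia}`. -/
def osc (a : ℝ) : ℂ := Complex.exp (Complex.I * (a : ℂ))

lemma norm_osc (a : ℝ) : ‖osc a‖ = 1 := by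
  rw [osc, mul_comm]; exact Complex.norm_exp_ofReal_mul_I a

lemma osc_add (a b : ℝ) : osc (a + b) = osc a * osc b := by
  rw [osc, osc, osc, ← Complex.exp_add]; push_cast; ring_nf

@[fun_prop]
lemma continuous_osc : Continuous osc := by unfold osc; fun_prop

lemma fourier_eq_integral_osc (g : ℝ → ℂ) (w : ℝ) :
    𝓕 g w = ∫ v, osc (-(2 * π * w) * v) * g v := by
  rw [Real.fourier_real_eq_integral_exp_smul]
  refine integral_congr_ae (.of_forall fun v => ?_)
  simp only [osc, smul_eq_mul]
  congr 2
  push_cast; ring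

/-- The `L²` Fourier transform agrees with the integral transform on `L¹ ∩ L²`. -/
lemma fourier_toLp_ae_eq {g : ℝ → ℂ} (h1 : Integrable g) (h2 : MemLp g 2) :
    (𝓕 (h2.toLp g) : Lp ℂ 2 (volume : Measure ℝ)) =ᵐ[volume] 𝓕 g := by
  have hcont : Continuous (𝓕 g) :=
    VectorFourier.fourierIntegral_continuous Real.continuous_fourierChar
      (innerSL ℝ).continuous₂ h1
  refine ae_eq_of_integral_contDiff_smul_eq ?_ hcont.locallyIntegrable ?_
  · exact (Lp.memLp _).locallyIntegrable (by norm_num)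
  intro φ hφ hc
  have hc' : HasCompactSupport (fun x => (φ x : ℂ)) :=
    hc.comp_left (g := fun r : ℝ => (r : ℂ)) Complex.ofReal_zero
  have hφ' : ContDiff ℝ (↑(⊤ : ℕ∞)) (fun x => (φ x : ℂ)) :=
    Complex.ofRealCLM.contDiff.comp hφ
  obtain ⟨ψ, hψφ⟩ : ∃ ψ : SchwartzMap ℝ ℂ, ∀ x, ψ x = (φ x : ℂ) :=
    ⟨hc'.toSchwartzMap hφ', fun x => rfl⟩
  have key := congrArg (fun D : TemperedDistribution ℝ ℂ => D ψ)
    (Lp.fourier_toTemperedDistribution_eq (h2.toLp g))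
  simp only [TemperedDistribution.fourier_apply, Lp.toTemperedDistribution_apply] at key
  have e1 : ∫ x, φ x • (𝓕 (h2.toLp g) : Lp ℂ 2 (volume : Measure ℝ)) x =
      ∫ x, ψ x • (𝓕 (h2.toLp g) : Lp ℂ 2 (volume : Measure ℝ)) x := by
    simp [hψφ]
  have e2 : ∫ x, φ x • 𝓕 g x = ∫ x, 𝓕 g x • ψ x := by
    simp [hψφ, mul_comm]
  rw [e1, ← key, e2]
  have e3 : ∫ x, (𝓕 ψ) x • (h2.toLp g) x = ∫ x, (𝓕 ψ) x • g x := by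
    refine integral_congr_ae ?_
    filter_upwards [h2.coeFn_toLp] with x hx
    rw [hx]
  rw [e3]
  have := VectorFourier.integral_fourierIntegral_smul_eq_flip (L := innerₗ ℝ) (μ := volume)
    (ν := volume) Real.continuous_fourierChar (innerSL ℝ).continuous₂ h1 ψ.integrable
  rw [flip_innerₗ] at this
  refine Eq.trans ?_ this.symm
  refine integral_congr_ae (.of_forall fun x => ?_)
  simp only [smul_eq_mul, SchwartzMap.fourier_coe]
  exact mul_comm _ _

lemma lintegral_enorm_sq_fourier {g : ℝ → ℂ} (h1 : Integrable g) (h2 : MemLp g 2) :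
    ∫⁻ w, ‖𝓕 g w‖ₑ ^ 2 = ∫⁻ v, ‖g v‖ₑ ^ 2 := by
  have h := Lp.norm_fourier_eq (h2.toLp g)
  have e : ∀ f : Lp ℂ 2 (volume : Measure ℝ), ∫⁻ w, ‖f w‖ₑ ^ 2 = ‖f‖ₑ ^ 2 := by
    intro f
    rw [Lp.enorm_def, eLpNorm_eq_lintegral_rpow_enorm_toReal (by norm_num) (by norm_num),
      ← ENNReal.rpow_two, ← ENNReal.rpow_mul]
    simp
  have h' : ‖(𝓕 (h2.toLp g) : Lp ℂ 2 (volume : Measure ℝ))‖ₑ = ‖h2.toLp g‖ₑ := by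
    rw [← ofReal_norm, h, ofReal_norm]
  calc ∫⁻ w, ‖𝓕 g w‖ₑ ^ 2
      = ∫⁻ w, ‖(𝓕 (h2.toLp g) : Lp ℂ 2 (volume : Measure ℝ)) w‖ₑ ^ 2 := by
        refine lintegral_congr_ae ?_
        filter_upwards [fourier_toLp_ae_eq h1 h2] with w hw
        rw [hw]
    _ = ∫⁻ w, ‖h2.toLp g w‖ₑ ^ 2 := by rw [e, e, h']
    _ = _ := by
        refine lintegral_congr_ae ?_
        filter_upwards [h2.coeFn_toLp] with w hw
        rw [hw]

lemma lintegral_comp_mul_left_eq (F : ℝ → ℝ≥0∞) {a : ℝ} (ha : a ≠ 0) :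
    ∫⁻ w, F (a * w) = ENNReal.ofReal |a⁻¹| * ∫⁻ w, F w := by
  have := (Homeomorph.mulLeft₀ a ha).measurableEmbedding.lintegral_map (μ := volume) F
  simp only [Homeomorph.coe_mulLeft₀] at this
  rw [← this, Real.map_volume_mul_left ha, lintegral_smul_measure, smul_eq_mul]

/-- Plancherel's identity for the transform with kernel `e^{iavw}`. -/
lemma lintegral_enorm_sq_osc {g : ℝ → ℂ} (h1 : Integrable g) (h2 : MemLp g 2) {a : ℝ}
    (ha : a ≠ 0) :
    ∫⁻ w, ‖∫ v, osc (a * w * v) * g v‖ₑ ^ 2 =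
      ENNReal.ofReal (2 * π / |a|) * ∫⁻ v, ‖g v‖ₑ ^ 2 := by
  have hb : -(a / (2 * π)) ≠ 0 := by simp [ha, Real.pi_ne_zero]
  have h := lintegral_comp_mul_left_eq (fun w => ‖𝓕 g w‖ₑ ^ 2) hb
  rw [lintegral_enorm_sq_fourier h1 h2] at h
  have e : |(-(a / (2 * π)))⁻¹| = 2 * π / |a| := by
    rw [abs_inv, abs_neg, abs_div, inv_div, abs_of_pos (by positivity : 0 < 2 * π)]
  rw [← e, ← h]
  refine lintegral_congr fun w => ?_
  rw [fourier_eq_integral_osc]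
  congr 3
  ext v
  congr 2
  field_simp

/-- Bessel's inequality, with no assumption on the function. -/
lemma lintegral_enorm_sq_osc_le (g : ℝ → ℂ) {a : ℝ} (ha : a ≠ 0) :
    ∫⁻ w, ‖∫ v, osc (a * w * v) * g v‖ₑ ^ 2 ≤
      ENNReal.ofReal (2 * π / |a|) * ∫⁻ v, ‖g v‖ₑ ^ 2 := by
  by_cases h1 : Integrable g
  · by_cases h2 : MemLp g 2
    · exact (lintegral_enorm_sq_osc h1 h2 ha).le
    · have : ∫⁻ v, ‖g v‖ₑ ^ 2 = ⊤ := by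
        by_contra hne
        refine h2 ⟨h1.1, ?_⟩
        rw [eLpNorm_lt_top_iff_lintegral_rpow_enorm_lt_top (by norm_num) (by norm_num)]
        simpa using lt_top_iff_ne_top.2 hne
      rw [this, ENNReal.mul_top]
      · exact le_top
      · simpa using by positivity
  · have : ∀ w, ∫ v, osc (a * w * v) * g v = 0 := by
      intro w
      refine integral_undef fun h => h1 ?_
      have h' := h.bdd_mul (c := 1) (f := fun v => osc (-(a * w * v)))
        (by fun_prop) (.of_forall fun v => (norm_osc _).le)
      refine h'.congr (.of_forall fun v => ?_)
      simp only [← mul_assoc, ← osc_add]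
      simp [osc]
    simp [this]

/-- Fourier inversion for the transform with kernel `e^{-iξv}`. -/
lemma integral_osc_integral_osc {g : ℝ → ℂ} (hg : Integrable g)
    (hg' : Integrable fun ξ => ∫ v, osc (-(ξ * v)) * g v) {y : ℝ} (hy : ContinuousAt g y) :
    ∫ ξ, osc (y * ξ) * ∫ v, osc (-(ξ * v)) * g v = 2 * π * g y := by
  have e : 𝓕 g = fun w => (fun ξ => ∫ v, osc (-(ξ * v)) * g v) (2 * π * w) := by
    ext w
    rw [fourier_eq_integral_osc]
    simp only [neg_mul]
  have hF : Integrable (𝓕 g) := by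
    rw [e]
    exact (integrable_comp_mul_left_iff _ (by positivity)).2 hg'
  have h := hg.fourierInv_fourier_eq hF hy
  rw [Real.fourierInv_eq'] at h
  have h2 := Measure.integral_comp_mul_left
    (fun ξ => osc (y * ξ) * ∫ v, osc (-(ξ * v)) * g v) (2 * π)
  have h3 : ∫ w : ℝ, osc (y * (2 * π * w)) * ∫ v, osc (-(2 * π * w * v)) * g v = g y := by
    rw [← h]
    refine integral_congr_ae (.of_forall fun w => ?_)
    simp only [e, smul_eq_mul, osc]
    congr 2
    simp; ring
  rw [h3] at h2
  rw [h2, abs_of_pos (by positivity : 0 < (2 * π)⁻¹), Complex.real_smul]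
  push_cast
  field_simp

/-- Lagrange interpolation of a quadratic numerator over a product of three linear factors. -/
lemma partial_fractions {R z p₁ p₂ p₃ : ℂ} (h12 : p₁ ≠ p₂) (h13 : p₁ ≠ p₃) (h23 : p₂ ≠ p₃)
    (h1 : z ≠ p₁) (h2 : z ≠ p₂) (h3 : z ≠ p₃) :
    (R - z ^ 2) / ((z - p₁) * (z - p₂) * (z - p₃)) =
      (R - p₁ ^ 2) / ((p₁ - p₂) * (p₁ - p₃)) * (z - p₁)⁻¹ +
      (R - p₂ ^ 2) / ((p₂ - p₁) * (p₂ - p₃)) * (z - p₂)⁻¹ +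
      (R - p₃ ^ 2) / ((p₃ - p₁) * (p₃ - p₂)) * (z - p₃)⁻¹ := by
  have a1 := sub_ne_zero.2 h12
  have a2 := sub_ne_zero.2 h13
  have a3 := sub_ne_zero.2 h23
  have b1 := sub_ne_zero.2 h1
  have b2 := sub_ne_zero.2 h2
  have b3 := sub_ne_zero.2 h3
  rw [← neg_sub p₁ p₂, ← neg_sub p₁ p₃, ← neg_sub p₂ p₃]
  field_simp
  ring

lemma exists_cubic_roots (R l : ℂ) : ∃ p₁ p₂ p₃ : ℂ, ∀ z : ℂ,
    z ^ 3 - R * z + l = (z - p₁) * (z - p₂) * (z - p₃) := by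
  obtain ⟨p, hp⟩ : ∃ p : ℂ, p ^ 3 - R * p + l = 0 := by
    have hd : (Polynomial.X ^ 3 - Polynomial.C R * Polynomial.X + Polynomial.C l).degree = 3 := by
      compute_degree!
    obtain ⟨p, hp⟩ := Complex.exists_root (by rw [hd]; norm_num)
    exact ⟨p, by simpa using hp⟩
  obtain ⟨s, hs⟩ := IsAlgClosed.exists_pow_nat_eq (p ^ 2 - 4 * (p ^ 2 - R)) (n := 2) (by norm_num)
  refine ⟨p, (-p + s) / 2, (-p - s) / 2, fun z => ?_⟩
  linear_combination hp + (z - p) / 4 * hs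

/-- The fundamental solution of `u' - p u = δ` decaying at infinity. -/
def expKernel (p : ℂ) (x : ℝ) : ℂ :=
  if p.re < 0 then Set.indicator (Set.Ioi 0) (fun y : ℝ => Complex.exp (p * y)) x
  else -Set.indicator (Set.Iio 0) (fun y : ℝ => Complex.exp (p * y)) x

lemma integrable_expKernel {p : ℂ} (hp : p.re ≠ 0) : Integrable (expKernel p) := by
  unfold expKernel
  by_cases h : p.re < 0
  · simp only [h, if_true]
    exact (integrableOn_exp_mul_complex_Ioi h 0).integrable_indicator measurableSet_Ioi
  · simp only [h, if_false]
    have h' : 0 < p.re := lt_of_le_of_ne (not_lt.1 h) hp.symm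
    exact (((integrableOn_exp_mul_complex_Iic h' 0).mono_set
      Set.Iio_subset_Iic_self).integrable_indicator measurableSet_Iio).neg

lemma integral_osc_expKernel {p : ℂ} (hp : p.re ≠ 0) (ξ : ℝ) :
    ∫ v, osc (-(ξ * v)) * expKernel p v = (Complex.I * ξ - p)⁻¹ := by
  have e : ∀ v : ℝ, osc (-(ξ * v)) * Complex.exp (p * v) =
      Complex.exp ((p - Complex.I * ξ) * v) := by
    intro v
    rw [osc, ← Complex.exp_add]
    congr 1; push_cast; ring
  have hre : (p - Complex.I * ξ).re = p.re := by simp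
  have hne : Complex.I * ξ - p ≠ 0 := by
    intro h; apply hp; rw [← hre, ← neg_sub, h]; simp
  have hne' : p - Complex.I * ξ ≠ 0 := by rw [← neg_sub]; exact neg_ne_zero.2 hne
  unfold expKernel
  by_cases h : p.re < 0
  · simp only [h, if_true]
    have : ∀ v : ℝ, osc (-(ξ * v)) *
        Set.indicator (Set.Ioi 0) (fun y : ℝ => Complex.exp (p * y)) v =
        Set.indicator (Set.Ioi 0) (fun y : ℝ => Complex.exp ((p - Complex.I * ξ) * y)) v := by
      intro v
      by_cases hv : v ∈ Set.Ioi (0:ℝ) <;> simp [hv, e]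
    simp only [this]
    rw [integral_indicator measurableSet_Ioi, integral_exp_mul_complex_Ioi (by rwa [hre])]
    simp only [Complex.ofReal_zero, mul_zero, Complex.exp_zero]
    rw [← neg_sub p]
    field_simp
  · simp only [h, if_false]
    have h' : 0 < p.re := lt_of_le_of_ne (not_lt.1 h) hp.symm
    have : ∀ v : ℝ, osc (-(ξ * v)) *
        -Set.indicator (Set.Iio 0) (fun y : ℝ => Complex.exp (p * y)) v =
        -Set.indicator (Set.Iio 0) (fun y : ℝ => Complex.exp ((p - Complex.I * ξ) * y)) v := by
      intro v
      by_cases hv : v ∈ Set.Iio (0:ℝ) <;> simp [hv, e]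
    simp only [this]
    rw [integral_neg, integral_indicator measurableSet_Iio, ← integral_Iic_eq_integral_Iio,
      integral_exp_mul_complex_Iic (by rwa [hre])]
    simp only [Complex.ofReal_zero, mul_zero, Complex.exp_zero]
    rw [← neg_sub p]
    field_simp

lemma continuousAt_expKernel (p : ℂ) {x : ℝ} (hx : x ≠ 0) : ContinuousAt (expKernel p) x := by
  have hc : ∀ y : ℝ, ContinuousAt (fun y : ℝ => Complex.exp (p * y)) y := fun y => by fun_prop
  have key : ∀ s : Set ℝ, x ∉ frontier s →
      ContinuousAt (Set.indicator s (fun y : ℝ => Complex.exp (p * y))) x := by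
    intro s hs
    by_cases h : x ∈ interior s
    · refine (hc x).congr ?_
      filter_upwards [isOpen_interior.mem_nhds h] with y hy
      rw [Set.indicator_of_mem (interior_subset hy)]
    · have h' : x ∉ closure s := fun hx' => hs ⟨hx', h⟩
      refine (continuousAt_const (y := (0:ℂ))).congr ?_
      filter_upwards [isClosed_closure.isOpen_compl.mem_nhds h'] with y hy
      rw [Set.indicator_of_notMem fun hy' => hy (subset_closure hy')]
  unfold expKernel
  by_cases h : p.re < 0
  · simp only [h, if_true]
    exact key _ (by simpa using hx)
  · simp only [h, if_false]
    exact (key _ (by simpa using hx)).neg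

lemma norm_expKernel_le_one {p : ℂ} {x : ℝ} (hx : 0 < x) : ‖expKernel p x‖ ≤ 1 := by
  unfold expKernel
  by_cases h : p.re < 0
  · simp only [h, if_true]
    rw [Set.indicator_of_mem (Set.mem_Ioi.2 hx), Complex.norm_exp]
    apply Real.exp_le_one_iff.2
    simp; nlinarith
  · simp only [h, if_false]
    rw [Set.indicator_of_notMem (by simpa using hx.le)]
    simp

lemma expKernel_eq_zero {p : ℂ} {x : ℝ} (hp : 0 ≤ p.re) (hx : 0 < x) : expKernel p x = 0 := by
  unfold expKernel
  simp [not_lt.2 hp, hx.le]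

section Roots

variable {ε τ ρ : ℝ} {p : ℂ}

/-- Real and imaginary parts of the characteristic equation. -/
lemma char_re_im (hp : p ^ 3 - ρ * p + (ε + τ * Complex.I) = 0) :
    p.re ^ 3 - 3 * p.re * p.im ^ 2 - ρ * p.re + ε = 0 ∧
      3 * p.re ^ 2 * p.im - p.im ^ 3 - ρ * p.im + τ = 0 := by
  have h1 := congrArg Complex.re hp
  have h2 := congrArg Complex.im hp
  simp [pow_succ] at h1 h2
  constructor <;> nlinarith

lemma char_root_re_ne_zero (hε : 0 < ε) (hp : p ^ 3 - ρ * p + (ε + τ * Complex.I) = 0) :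
    p.re ≠ 0 := by
  intro h
  have := (char_re_im hp).1
  simp [h] at this
  exact hε.ne' this

lemma char_root_simple (hε : 0 < ε) (hτ : τ ≠ 0)
    (hp : p ^ 3 - ρ * p + (ε + τ * Complex.I) = 0) : 3 * p ^ 2 - ρ ≠ 0 := by
  intro h
  have h2 := congrArg Complex.im h
  simp [pow_succ] at h2
  have h3 : p.re * p.im = 0 := by linarith
  have h4 : p.im = 0 := (mul_eq_zero.1 h3).resolve_left (char_root_re_ne_zero hε hp)
  have := (char_re_im hp).2
  simp [h4] at this
  exact hτ this

/-- Residues at the roots in the left half plane are bounded by one. -/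
lemma norm_residue_le (hε : 0 < ε) (hρ : 0 ≤ ρ) (hre : p.re < 0)
    (hp : p ^ 3 - ρ * p + (ε + τ * Complex.I) = 0) :
    ‖((ρ : ℂ) - p ^ 2) / (3 * p ^ 2 - ρ)‖ ≤ 1 := by
  have h1 := (char_re_im hp).1
  have h2 : p.re ^ 2 > 3 * p.im ^ 2 + ρ := by
    by_contra! h
    nlinarith
  have h3 : ρ ≤ ‖p‖ ^ 2 := by
    rw [Complex.sq_norm, Complex.normSq_apply]; nlinarith [sq_nonneg p.im]
  have hpp : 0 < ‖p‖ ^ 2 := by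
    rw [Complex.sq_norm, Complex.normSq_apply]; nlinarith [sq_nonneg p.im]
  have hn : ‖(ρ : ℂ) - p ^ 2‖ ≤ 2 * ‖p‖ ^ 2 := by
    refine (norm_sub_le _ _).trans ?_
    rw [norm_pow, Complex.norm_real, Real.norm_of_nonneg hρ]; linarith
  have hd : 2 * ‖p‖ ^ 2 ≤ ‖3 * p ^ 2 - (ρ : ℂ)‖ := by
    refine le_trans ?_ (norm_sub_norm_le _ _)
    rw [norm_mul, norm_pow, Complex.norm_real, Real.norm_of_nonneg hρ]
    norm_num; linarith
  rw [norm_div]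
  exact (div_le_one (by linarith)).2 (hn.trans hd)

end Roots

/-- The multiplier of the resolvent. -/
def resolventSymbol (ε τ ρ ξ : ℝ) : ℂ :=
  ((ξ ^ 2 + ρ : ℝ) : ℂ) / ((ε + τ * Complex.I) - Complex.I * ((ξ * (ξ ^ 2 + ρ) : ℝ) : ℂ))

/-- The derivative of `arctan ((ω(ξ) - τ) / ε)`. -/
def lorentz (ε τ ρ ξ : ℝ) : ℝ :=
  (3 * ξ ^ 2 + ρ) * ε / (ε ^ 2 + (ξ * (ξ ^ 2 + ρ) - τ) ^ 2)

lemma lorentz_nonneg {ε τ ρ : ℝ} (hε : 0 < ε) (hρ : 0 ≤ ρ) (ξ : ℝ) : 0 ≤ lorentz ε τ ρ ξ := by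
  unfold lorentz; positivity

lemma continuous_lorentz {ε τ ρ : ℝ} (hε : 0 < ε) : Continuous (lorentz ε τ ρ) := by
  unfold lorentz
  refine Continuous.div (by fun_prop) (by fun_prop) fun ξ => ?_
  positivity

lemma integral_lorentz_le_interval {ε τ ρ : ℝ} (hε : 0 < ε) (a b : ℝ) :
    ∫ ξ in a..b, lorentz ε τ ρ ξ ≤ π := by
  have hd : ∀ ξ ∈ Set.uIcc a b, HasDerivAt
      (fun ξ => arctan ((ξ * (ξ ^ 2 + ρ) - τ) / ε)) (lorentz ε τ ρ ξ) ξ := by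
    intro ξ _
    have h1 : HasDerivAt (fun ξ : ℝ => (ξ * (ξ ^ 2 + ρ) - τ) / ε) ((3 * ξ ^ 2 + ρ) / ε) ξ := by
      have := (((hasDerivAt_id ξ).mul ((hasDerivAt_pow 2 ξ).add_const ρ)).sub_const τ).div_const ε
      refine this.congr_deriv ?_
      simp; ring
    refine h1.arctan.congr_deriv ?_
    unfold lorentz
    field_simp
  rw [intervalIntegral.integral_eq_sub_of_hasDerivAt hd
    ((continuous_lorentz hε).intervalIntegrable _ _)]
  have h1 := arctan_lt_pi_div_two ((b * (b ^ 2 + ρ) - τ) / ε)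
  have h2 := neg_pi_div_two_lt_arctan ((a * (a ^ 2 + ρ) - τ) / ε)
  linarith

lemma integrable_lorentz {ε τ ρ : ℝ} (hε : 0 < ε) (hρ : 0 ≤ ρ) :
    Integrable (lorentz ε τ ρ) := by
  refine integrable_of_intervalIntegral_norm_bounded (ι := ℝ) (l := atTop) (a := fun r => -r)
    (b := fun r => r) π (fun r => ((continuous_lorentz hε).integrableOn_Icc).mono_set
    Set.Ioc_subset_Icc_self) tendsto_neg_atTop_atBot tendsto_id (.of_forall fun r => ?_)
  simp only [Real.norm_of_nonneg (lorentz_nonneg hε hρ _)]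
  exact integral_lorentz_le_interval hε _ _

lemma integral_lorentz_le {ε τ ρ : ℝ} (hε : 0 < ε) (hρ : 0 ≤ ρ) :
    ∫ ξ, lorentz ε τ ρ ξ ≤ π :=
  le_of_tendsto (intervalIntegral_tendsto_integral (integrable_lorentz hε hρ)
    tendsto_neg_atTop_atBot tendsto_id) (.of_forall fun _ => integral_lorentz_le_interval hε _ _)

lemma resolventSymbol_add_conj (ε τ ρ ξ : ℝ) :
    resolventSymbol ε τ ρ ξ + (starRingEnd ℂ) (resolventSymbol ε τ ρ ξ) =
      ((2 * (ξ ^ 2 + ρ) * ε / (ε ^ 2 + (ξ * (ξ ^ 2 + ρ) - τ) ^ 2) : ℝ) : ℂ) := by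
  rw [Complex.add_conj]
  congr 1
  unfold resolventSymbol
  have e : (ε + τ * Complex.I) - Complex.I * ((ξ * (ξ ^ 2 + ρ) : ℝ) : ℂ) =
      ⟨ε, τ - ξ * (ξ ^ 2 + ρ)⟩ := by
    apply Complex.ext <;> simp [pow_succ]
  rw [e, Complex.div_re, Complex.normSq_mk]
  simp only [Complex.ofReal_re, Complex.ofReal_im, zero_mul, zero_div, add_zero]
  rw [show ε * ε + (τ - ξ * (ξ ^ 2 + ρ)) * (τ - ξ * (ξ ^ 2 + ρ)) =
    ε ^ 2 + (ξ * (ξ ^ 2 + ρ) - τ) ^ 2 by ring]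
  ring

lemma norm_resolventSymbol_add_conj_le {ε τ ρ : ℝ} (hε : 0 < ε) (hρ : 0 ≤ ρ) (ξ : ℝ) :
    ‖resolventSymbol ε τ ρ ξ + (starRingEnd ℂ) (resolventSymbol ε τ ρ ξ)‖ ≤
      2 * lorentz ε τ ρ ξ := by
  rw [resolventSymbol_add_conj, Complex.norm_real, Real.norm_of_nonneg (by positivity), lorentz,
    ← mul_div_assoc]
  gcongr ?_ / _
  nlinarith [sq_nonneg ξ]

/-- The resolvent symbol is the Fourier transform of a bounded integrable kernel, with a bound
independent of all parameters. -/
lemma exists_resolvent_kernel {ε τ ρ : ℝ} (hε : 0 < ε) (hτ : τ ≠ 0) (hρ : 0 ≤ ρ) :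
    ∃ G : ℝ → ℂ, Integrable G ∧ (∀ ξ, ∫ v, osc (-(ξ * v)) * G v = resolventSymbol ε τ ρ ξ) ∧
      ∀ x, x ≠ 0 → ‖G x‖ ≤ 4 := by
  obtain ⟨p₁, p₂, p₃, hp⟩ := exists_cubic_roots (ρ : ℂ) (ε + τ * Complex.I)
  have r1 : p₁ ^ 3 - ρ * p₁ + (ε + τ * Complex.I) = 0 := by rw [hp]; ring
  have r2 : p₂ ^ 3 - ρ * p₂ + (ε + τ * Complex.I) = 0 := by rw [hp]; ring
  have r3 : p₃ ^ 3 - ρ * p₃ + (ε + τ * Complex.I) = 0 := by rw [hp]; ring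
  -- Vieta relations
  have e0 := hp 0
  have e1 := hp 1
  have em := hp (-1)
  have hs : p₁ + p₂ + p₃ = 0 := by linear_combination (e1 + em) / 2 - e0
  have hR : (ρ : ℂ) = -(p₁ * p₂ + p₁ * p₃ + p₂ * p₃) := by
    linear_combination (em - e1) / 2
  have d1 : (p₁ - p₂) * (p₁ - p₃) = 3 * p₁ ^ 2 - ρ := by
    rw [hR]; linear_combination (-2 * p₁) * hs
  have d2 : (p₂ - p₁) * (p₂ - p₃) = 3 * p₂ ^ 2 - ρ := by
    rw [hR]; linear_combination (-2 * p₂) * hs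
  have d3 : (p₃ - p₁) * (p₃ - p₂) = 3 * p₃ ^ 2 - ρ := by
    rw [hR]; linear_combination (-2 * p₃) * hs
  have s1 := char_root_simple hε hτ r1
  have s2 := char_root_simple hε hτ r2
  have h12 : p₁ ≠ p₂ := by
    rintro rfl; rw [← d1, sub_self, zero_mul] at s1; exact s1 rfl
  have h13 : p₁ ≠ p₃ := by
    rintro rfl; rw [← d1, sub_self, mul_zero] at s1; exact s1 rfl
  have h23 : p₂ ≠ p₃ := by
    rintro rfl; rw [← d2, sub_self, mul_zero] at s2; exact s2 rfl
  have n1 := char_root_re_ne_zero hε r1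
  have n2 := char_root_re_ne_zero hε r2
  have n3 := char_root_re_ne_zero hε r3
  set A : ℂ → ℂ := fun p => ((ρ : ℂ) - p ^ 2) / (3 * p ^ 2 - ρ) with hA
  set G : ℝ → ℂ := fun v => A p₁ * expKernel p₁ v + A p₂ * expKernel p₂ v + A p₃ * expKernel p₃ v
    with hG
  have i1 := (integrable_expKernel n1).const_mul (A p₁)
  have i2 := (integrable_expKernel n2).const_mul (A p₂)
  have i3 := (integrable_expKernel n3).const_mul (A p₃)
  have hGi : Integrable G := (i1.add i2).add i3
  have osc_int : ∀ {g : ℝ → ℂ}, Integrable g → ∀ ξ, Integrable fun v => osc (-(ξ * v)) * g v :=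
    fun hg ξ => hg.bdd_mul (c := 1) (by fun_prop) (.of_forall fun v => (norm_osc _).le)
  have hGF : ∀ ξ, ∫ v, osc (-(ξ * v)) * G v = resolventSymbol ε τ ρ ξ := by
    intro ξ
    have hz : ∀ p : ℂ, p.re ≠ 0 → Complex.I * ξ ≠ p := by
      rintro _ h rfl; simp at h
    have pf := partial_fractions (R := ρ) h12 h13 h23 (hz _ n1) (hz _ n2) (hz _ n3)
    rw [← hp, d1, d2, d3] at pf
    calc ∫ v, osc (-(ξ * v)) * G v
        = ∫ v, (A p₁ * (osc (-(ξ * v)) * expKernel p₁ v) +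
            A p₂ * (osc (-(ξ * v)) * expKernel p₂ v)) +
            A p₃ * (osc (-(ξ * v)) * expKernel p₃ v) := by
          congr 1; ext v; simp only [hG]; ring
      _ = A p₁ * (Complex.I * ξ - p₁)⁻¹ + A p₂ * (Complex.I * ξ - p₂)⁻¹ +
            A p₃ * (Complex.I * ξ - p₃)⁻¹ := by
          have j1 := (osc_int (integrable_expKernel n1) ξ).const_mul (A p₁)
          have j2 := (osc_int (integrable_expKernel n2) ξ).const_mul (A p₂)
          have j3 := (osc_int (integrable_expKernel n3) ξ).const_mul (A p₃)
          have j12 : Integrable fun v => A p₁ * (osc (-(ξ * v)) * expKernel p₁ v) +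
              A p₂ * (osc (-(ξ * v)) * expKernel p₂ v) := j1.add j2
          rw [integral_add j12 j3, integral_add j1 j2]
          simp only [integral_const_mul]
          rw [integral_osc_expKernel n1, integral_osc_expKernel n2, integral_osc_expKernel n3]
      _ = resolventSymbol ε τ ρ ξ := by
          rw [hA, ← pf, resolventSymbol]
          congr 1
          · push_cast; linear_combination (-(ξ : ℂ) ^ 2) * Complex.I_sq
          · push_cast; linear_combination (Complex.I * (ξ : ℂ) ^ 3) * Complex.I_sq
  have hpos : ∀ x, 0 < x → ‖G x‖ ≤ 3 := by
    intro x hx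
    have key : ∀ p : ℂ, p ^ 3 - ρ * p + (ε + τ * Complex.I) = 0 →
        ‖A p * expKernel p x‖ ≤ 1 := by
      intro p hr
      by_cases h : p.re < 0
      · rw [norm_mul]
        exact mul_le_one₀ (norm_residue_le hε hρ h hr) (norm_nonneg _) (norm_expKernel_le_one hx)
      · rw [expKernel_eq_zero (not_lt.1 h) hx]; simp
    have := norm_add₃_le (a := A p₁ * expKernel p₁ x) (b := A p₂ * expKernel p₂ x)
      (c := A p₃ * expKernel p₃ x)
    have := key _ r1
    have := key _ r2
    have := key _ r3
    linarith
  refine ⟨G, hGi, hGF, fun x hx => ?_⟩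
  rcases lt_or_gt_of_ne hx with hneg | hx0
  swap
  · linarith [hpos x hx0]
  -- the symmetrized kernel has an absolutely integrable transform
  set H : ℝ → ℂ := fun v => G v + (starRingEnd ℂ) (G (-v)) with hH
  have hconj : Integrable fun v => (starRingEnd ℂ) (G (-v)) :=
    (Complex.conjLIE.toLinearIsometry.toContinuousLinearMap.integrable_comp hGi.comp_neg :)
  have hHi : Integrable H := hGi.add hconj
  have hHF : ∀ ξ, ∫ v, osc (-(ξ * v)) * H v =
      resolventSymbol ε τ ρ ξ + (starRingEnd ℂ) (resolventSymbol ε τ ρ ξ) := by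
    intro ξ
    simp only [hH, mul_add]
    rw [integral_add (osc_int hGi ξ) (osc_int hconj ξ), hGF]
    congr 1
    rw [← hGF, ← integral_conj,
      ← integral_neg_eq_self (fun v => (starRingEnd ℂ) (osc (-(ξ * v)) * G v))]
    congr 1; ext v
    rw [map_mul]
    congr 1
    rw [osc, osc, ← Complex.exp_conj]
    simp
  have hGc : ∀ y, y ≠ 0 → ContinuousAt G y := fun y hy =>
    (((continuousAt_expKernel p₁ hy).const_mul _).add
      ((continuousAt_expKernel p₂ hy).const_mul _)).add ((continuousAt_expKernel p₃ hy).const_mul _)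
  have hHc : ContinuousAt H x := by
    refine (hGc x hx).add (Complex.continuous_conj.continuousAt.comp ?_)
    exact ContinuousAt.comp (f := fun y : ℝ => -y) (hGc (-x) (neg_ne_zero.2 hx))
      continuous_neg.continuousAt
  have hcontsym : Continuous fun ξ => ∫ v, osc (-(ξ * v)) * H v := by
    refine continuous_of_dominated (bound := fun v => ‖H v‖)
      (fun ξ => (osc_int hHi ξ).aestronglyMeasurable)
      (fun ξ => .of_forall fun v => ?_) hHi.norm (.of_forall fun v => ?_)
    · rw [norm_mul, norm_osc, one_mul]
    · fun_prop
  have hle : ∀ ξ, ‖∫ v, osc (-(ξ * v)) * H v‖ ≤ 2 * lorentz ε τ ρ ξ := fun ξ => by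
    rw [hHF]; exact norm_resolventSymbol_add_conj_le hε hρ ξ
  have hint : Integrable fun ξ => ∫ v, osc (-(ξ * v)) * H v :=
    ((integrable_lorentz hε hρ).const_mul 2).mono' hcontsym.aestronglyMeasurable (.of_forall hle)
  have hinv := integral_osc_integral_osc hHi hint hHc
  have hb : ‖2 * (π : ℂ) * H x‖ ≤ 2 * π := by
    rw [← hinv]
    refine (norm_integral_le_integral_norm _).trans ?_
    calc ∫ ξ, ‖osc (x * ξ) * ∫ v, osc (-(ξ * v)) * H v‖
        ≤ ∫ ξ, 2 * lorentz ε τ ρ ξ := by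
          refine integral_mono_of_nonneg (.of_forall fun ξ => norm_nonneg _)
            ((integrable_lorentz (τ := τ) hε hρ).const_mul 2) (.of_forall fun ξ => ?_)
          simp only [norm_mul, norm_osc, one_mul]
          exact hle ξ
      _ ≤ 2 * π := by
          rw [integral_const_mul]
          linarith [integral_lorentz_le (τ := τ) hε hρ]
  have hHx : ‖H x‖ ≤ 1 := by
    rw [norm_mul, norm_mul, Complex.norm_real, Real.norm_of_nonneg pi_pos.le] at hb
    norm_num at hb
    nlinarith [pi_pos]
  have : G x = H x - (starRingEnd ℂ) (G (-x)) := by simp [hH]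
  rw [this]
  refine (norm_sub_le _ _).trans ?_
  rw [RCLike.norm_conj]
  linarith [hpos (-x) (by linarith)]

/-- The uniform `L¹ → L^∞` bound for the resolvent multiplier. -/
lemma norm_integral_resolventSymbol_le {ε τ ρ : ℝ} (hε : 0 < ε) (hτ : τ ≠ 0) (hρ : 0 ≤ ρ)
    {g : ℝ → ℂ} (hc : Continuous g) (hg : Integrable g)
    (hg' : Integrable fun ξ => ∫ v, osc (-(ξ * v)) * g v) (x : ℝ) :
    ‖∫ ξ, osc (x * ξ) * (resolventSymbol ε τ ρ ξ * ∫ v, osc (-(ξ * v)) * g v)‖ ≤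
      8 * π * ∫ v, ‖g v‖ := by
  obtain ⟨G, hG, hGF, hGb⟩ := exists_resolvent_kernel hε hτ hρ
  set gh : ℝ → ℂ := fun ξ => ∫ v, osc (-(ξ * v)) * g v with hgh
  have h1 : ∫ ξ, osc (x * ξ) * (resolventSymbol ε τ ρ ξ * gh ξ) =
      ∫ ξ, ∫ u, osc ((x - u) * ξ) * (gh ξ * G u) := by
    congr 1; ext ξ
    rw [← hGF, ← integral_mul_const, ← integral_const_mul]
    congr 1; ext u
    rw [show (x - u) * ξ = x * ξ + -(ξ * u) by ring, osc_add]
    ring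
  have h2 : Integrable (Function.uncurry fun ξ u => osc ((x - u) * ξ) * (gh ξ * G u))
      (volume.prod volume) :=
    (hg'.mul_prod hG).bdd_mul (c := 1) (by fun_prop) (.of_forall fun v => (norm_osc _).le)
  rw [h1, integral_integral_swap h2]
  have h3 : ∀ u, ∫ ξ, osc ((x - u) * ξ) * (gh ξ * G u) = 2 * π * g (x - u) * G u := by
    intro u
    rw [← integral_osc_integral_osc hg hg' hc.continuousAt, ← integral_mul_const]
    congr 1; ext ξ; ring
  simp only [h3]
  have hgx : Integrable fun u => g (x - u) := hg.comp_sub_left x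
  calc ‖∫ u, 2 * π * g (x - u) * G u‖
      ≤ ∫ u, ‖2 * π * g (x - u) * G u‖ := norm_integral_le_integral_norm _
    _ ≤ ∫ u, 8 * π * ‖g (x - u)‖ := by
        refine integral_mono_of_nonneg (.of_forall fun ξ => norm_nonneg _)
          (hgx.norm.const_mul _) ?_
        have : ∀ᵐ u : ℝ, u ≠ 0 := by simp [ae_iff, measure_singleton]
        filter_upwards [this] with u hu
        rw [norm_mul, norm_mul, norm_mul, Complex.norm_real, Real.norm_of_nonneg pi_pos.le]
        have := hGb u hu
        norm_num
        nlinarith [mul_nonneg pi_pos.le (norm_nonneg (g (x - u)))]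
    _ = 8 * π * ∫ v, ‖g v‖ := by
        rw [integral_const_mul, integral_sub_left_eq_self (fun v => ‖g v‖) volume x]

end FourierKernels

section Duhamel

open scoped LineDeriv

/-- The integrable weight `(1 + x²)⁻¹`. -/
def wt (x : ℝ) : ℝ := (1 + x ^ 2)⁻¹

lemma wt_pos (x : ℝ) : 0 < wt x := by unfold wt; positivity

lemma wt_le_one (x : ℝ) : wt x ≤ 1 := by
  unfold wt; exact inv_le_one_of_one_le₀ (by nlinarith [sq_nonneg x])

lemma integrable_wt : Integrable wt := integrable_inv_one_add_sq

lemma exists_schwartz_decay (f : SchwartzMap (ℝ × ℝ × ℝ × ℝ) ℂ) :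
    ∃ C : ℝ, 0 < C ∧ ∀ s x y z, ‖f (s, x, y, z)‖ ≤ C * wt s * wt x * wt y * wt z := by
  set S := 2 ^ 8 * ((Finset.Iic ((8 : ℕ), (0 : ℕ))).sup
    (fun m => SchwartzMap.seminorm ℝ m.1 m.2)) f with hS
  have hS0 : 0 ≤ S := by positivity
  refine ⟨S + 1, by positivity, fun s x y z => ?_⟩
  have h := SchwartzMap.one_add_le_sup_seminorm_apply (𝕜 := ℝ) (m := ((8 : ℕ), (0 : ℕ)))
    (k := 8) (n := 0) le_rfl le_rfl f (s, x, y, z)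
  rw [norm_iteratedFDeriv_zero] at h
  set R := ‖((s, x, y, z) : ℝ × ℝ × ℝ × ℝ)‖ with hR
  have hR0 : 0 ≤ R := norm_nonneg _
  have h1 : |s| ≤ R ∧ |x| ≤ R ∧ |y| ≤ R ∧ |z| ≤ R := by
    simp only [hR, Prod.norm_def, Real.norm_eq_abs]
    refine ⟨?_, ?_, ?_, ?_⟩ <;> simp
  have key : ∀ u : ℝ, |u| ≤ R → 1 + u ^ 2 ≤ (1 + R) ^ 2 := fun u hu => by
    rw [← sq_abs u]; nlinarith [abs_nonneg u]
  obtain ⟨h1, h2, h3, h4⟩ := h1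
  have h5 : (1 + s ^ 2) * (1 + x ^ 2) * (1 + y ^ 2) * (1 + z ^ 2) ≤ (1 + R) ^ 8 := by
    calc _ ≤ (1 + R) ^ 2 * (1 + R) ^ 2 * (1 + R) ^ 2 * (1 + R) ^ 2 := by
          gcongr <;> exact key _ ‹_›
      _ = _ := by ring
  have h6 : (1 + s ^ 2) * (1 + x ^ 2) * (1 + y ^ 2) * (1 + z ^ 2) * ‖f (s, x, y, z)‖ ≤ S + 1 := by
    calc _ ≤ (1 + R) ^ 8 * ‖f (s, x, y, z)‖ := by gcongr
      _ ≤ S := h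
      _ ≤ S + 1 := by linarith
  calc ‖f (s, x, y, z)‖ = ((1 + s ^ 2) * (1 + x ^ 2) * (1 + y ^ 2) * (1 + z ^ 2) *
        ‖f (s, x, y, z)‖) * (wt s * wt x * wt y * wt z) := by
        unfold wt; field_simp
    _ ≤ (S + 1) * (wt s * wt x * wt y * wt z) := by
        gcongr
        have := wt_pos s; have := wt_pos x; have := wt_pos y; have := wt_pos z; positivity
    _ = _ := by ring

lemma FT3_eq_osc (φ : ℝ × ℝ × ℝ → ℂ) (ξ : ℝ × ℝ × ℝ) :
    FT3 φ ξ = ((((2 * π) ^ 3)⁻¹ : ℝ) : ℂ) * ∫ x : ℝ × ℝ × ℝ, osc (-dot3 x ξ) * φ x := by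
  simp only [FT3, osc]
  congr 1
  refine integral_congr_ae (.of_forall fun v => ?_)
  simp only
  congr 2
  push_cast; ring

lemma integrable_wt3 (c : ℝ) :
    Integrable (fun p : ℝ × ℝ × ℝ => c * (wt p.1 * (wt p.2.1 * wt p.2.2))) :=
  (integrable_wt.mul_prod (integrable_wt.mul_prod integrable_wt)).const_mul c

lemma continuous_slice (f : SchwartzMap (ℝ × ℝ × ℝ × ℝ) ℂ) (s : ℝ) :
    Continuous fun p : ℝ × ℝ × ℝ => f (s, p) :=
  f.continuous.comp (by fun_prop)

lemma integrable_slice (f : SchwartzMap (ℝ × ℝ × ℝ × ℝ) ℂ) (s : ℝ) :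
    Integrable fun p : ℝ × ℝ × ℝ => f (s, p) := by
  obtain ⟨C, -, hC⟩ := exists_schwartz_decay f
  refine (integrable_wt3 (C * wt s)).mono' (continuous_slice f s).aestronglyMeasurable
    (.of_forall fun p => ?_)
  refine (hC s p.1 p.2.1 p.2.2).trans (le_of_eq (by ring))

lemma integrable_osc_mul {α : Type*} [MeasurableSpace α] {ν : Measure α} {φ : α → ℂ}
    (hφ : Integrable φ ν) {h : α → ℝ} (hh : Measurable h) :
    Integrable (fun x => osc (h x) * φ x) ν :=
  hφ.bdd_mul (c := 1) (continuous_osc.measurable.comp hh).aestronglyMeasurable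
    (.of_forall fun _ => (norm_osc _).le)

lemma exists_FT3_le (f : SchwartzMap (ℝ × ℝ × ℝ × ℝ) ℂ) :
    ∃ C : ℝ, 0 < C ∧ ∀ s ξ, ‖FT3 (fun w => f (s, w)) ξ‖ ≤ C * wt s := by
  obtain ⟨C, hC0, hC⟩ := exists_schwartz_decay f
  set J := ∫ p : ℝ × ℝ × ℝ, (wt p.1 * (wt p.2.1 * wt p.2.2)) with hJ
  have hJ0 : 0 ≤ J := integral_nonneg fun p => by
    have := wt_pos p.1; have := wt_pos p.2.1; have := wt_pos p.2.2; positivity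
  refine ⟨((2 * π) ^ 3)⁻¹ * (C * J) + 1, by positivity, fun s ξ => ?_⟩
  rw [FT3_eq_osc, norm_mul, Complex.norm_real, Real.norm_of_nonneg (by positivity)]
  have : ‖∫ x : ℝ × ℝ × ℝ, osc (-dot3 x ξ) * f (s, x)‖ ≤ C * wt s * J := by
    rw [hJ, ← integral_const_mul]
    refine norm_integral_le_of_norm_le (integrable_wt3 _) (.of_forall fun p => ?_)
    rw [norm_mul, norm_osc, one_mul]
    exact (hC s p.1 p.2.1 p.2.2).trans (le_of_eq (by ring))
  calc _ ≤ ((2 * π) ^ 3)⁻¹ * (C * wt s * J) := by gcongr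
    _ = ((2 * π) ^ 3)⁻¹ * (C * J) * wt s := by ring
    _ ≤ _ := by have := wt_pos s; gcongr; linarith

lemma FT3_lineDeriv (f : SchwartzMap (ℝ × ℝ × ℝ × ℝ) ℂ) (e : ℝ × ℝ × ℝ) (s : ℝ)
    (ξ : ℝ × ℝ × ℝ) :
    FT3 (fun w => (∂_{((0 : ℝ), e)} f) (s, w)) ξ =
      Complex.I * (dot3 e ξ : ℝ) * FT3 (fun w => f (s, w)) ξ := by
  have hd : ∀ x : ℝ × ℝ × ℝ, HasLineDerivAt ℝ (fun w => f (s, w))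
      ((∂_{((0 : ℝ), e)} f) (s, x)) x e := fun x => by
    have h1 := (f.differentiableAt (x := (s, x))).hasFDerivAt.hasLineDerivAt ((0 : ℝ), e)
    rw [SchwartzMap.lineDerivOp_apply_eq_fderiv]
    simpa [HasLineDerivAt] using h1
  have ho : ∀ x : ℝ × ℝ × ℝ, HasLineDerivAt ℝ (fun w => osc (-dot3 w ξ))
      (-(Complex.I * (dot3 e ξ : ℝ)) * osc (-dot3 x ξ)) x e := fun x => by
    unfold HasLineDerivAt
    have h2 : (fun t : ℝ => osc (-dot3 (x + t • e) ξ)) = fun t : ℝ =>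
        Complex.exp (Complex.I * ((-dot3 x ξ : ℝ) + (t : ℂ) * (-dot3 e ξ : ℝ))) := by
      funext t
      simp only [osc, dot3]
      congr 2
      push_cast
      simp only [Prod.fst_add, Prod.snd_add, Prod.smul_fst, Prod.smul_snd, smul_eq_mul]
      push_cast; ring
    rw [h2]
    have h3 : HasDerivAt (fun t : ℝ => (t : ℂ)) 1 0 := Complex.ofRealCLM.hasDerivAt
    have h4 := (((h3.mul_const (((-dot3 e ξ : ℝ)) : ℂ)).const_add
      ((-dot3 x ξ : ℝ) : ℂ)).const_mul Complex.I).cexp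
    refine h4.congr_deriv ?_
    simp only [osc]
    push_cast; ring_nf
  have hm : Measurable fun x : ℝ × ℝ × ℝ => -dot3 x ξ := by unfold dot3; fun_prop
  have : (volume : Measure (ℝ × ℝ × ℝ)).IsAddHaarMeasure := by
    have : (volume : Measure (ℝ × ℝ)).IsAddHaarMeasure :=
      Measure.prod.instIsAddHaarMeasure (volume : Measure ℝ) (volume : Measure ℝ)
    exact Measure.prod.instIsAddHaarMeasure (volume : Measure ℝ) (volume : Measure (ℝ × ℝ))
  have key := integral_bilinear_hasLineDerivAt_right_eq_neg_left_of_integrable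
    (μ := (volume : Measure (ℝ × ℝ × ℝ)))
    (B := ContinuousLinearMap.mul ℝ ℂ) (f := fun w => osc (-dot3 w ξ))
    (f' := fun x => -(Complex.I * (dot3 e ξ : ℝ)) * osc (-dot3 x ξ))
    (g := fun w => f (s, w)) (g' := fun w => (∂_{((0 : ℝ), e)} f) (s, w)) (v := e)
    (by
      simpa only [ContinuousLinearMap.mul_apply', mul_assoc] using
        (integrable_osc_mul (integrable_slice f s) hm).const_mul (-(Complex.I * (dot3 e ξ : ℝ))))
    (by simpa only [ContinuousLinearMap.mul_apply'] using
        integrable_osc_mul (integrable_slice _ s) hm)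
    (by simpa only [ContinuousLinearMap.mul_apply'] using
        integrable_osc_mul (integrable_slice _ s) hm)
    (fun x _ => ho x) (fun x _ => hd x)
  simp only [ContinuousLinearMap.mul_apply', mul_assoc] at key
  rw [FT3_eq_osc, FT3_eq_osc, key, integral_const_mul]
  ring


/-- The operator `1 - ∂²` in the spatial direction `e`. -/
def oneSubSq (e : ℝ × ℝ × ℝ) (f : SchwartzMap (ℝ × ℝ × ℝ × ℝ) ℂ) :
    SchwartzMap (ℝ × ℝ × ℝ × ℝ) ℂ :=
  f - ∂_{((0 : ℝ), e)} (∂_{((0 : ℝ), e)} f)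

lemma FT3_sub {φ ψ : ℝ × ℝ × ℝ → ℂ} (hφ : Integrable φ) (hψ : Integrable ψ) (ξ : ℝ × ℝ × ℝ) :
    FT3 (fun w => φ w - ψ w) ξ = FT3 φ ξ - FT3 ψ ξ := by
  have hm : Measurable fun x : ℝ × ℝ × ℝ => -dot3 x ξ := by unfold dot3; fun_prop
  rw [FT3_eq_osc, FT3_eq_osc, FT3_eq_osc, ← mul_sub,
    ← integral_sub (integrable_osc_mul hφ hm) (integrable_osc_mul hψ hm)]
  simp only [mul_sub]

lemma FT3_oneSubSq (f : SchwartzMap (ℝ × ℝ × ℝ × ℝ) ℂ) (e : ℝ × ℝ × ℝ) (s : ℝ)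
    (ξ : ℝ × ℝ × ℝ) :
    FT3 (fun w => oneSubSq e f (s, w)) ξ =
      ((1 + dot3 e ξ ^ 2 : ℝ) : ℂ) * FT3 (fun w => f (s, w)) ξ := by
  simp only [oneSubSq, sub_apply]
  rw [FT3_sub (integrable_slice _ s) (integrable_slice _ s), FT3_lineDeriv, FT3_lineDeriv]
  push_cast
  linear_combination (-(dot3 e ξ : ℂ) ^ 2 * FT3 (fun w => f (s, w)) ξ) * Complex.I_sq

lemma exists_FT3_decay (f : SchwartzMap (ℝ × ℝ × ℝ × ℝ) ℂ) :
    ∃ C : ℝ, 0 < C ∧ ∀ s ξ η μ, ‖FT3 (fun w => f (s, w)) (ξ, η, μ)‖ ≤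
      C * (wt ξ ^ 2 * wt η ^ 2 * wt μ ^ 2) := by
  obtain ⟨C, hC0, hC⟩ := exists_FT3_le (oneSubSq (1, 0, 0) (oneSubSq (1, 0, 0)
    (oneSubSq (0, 1, 0) (oneSubSq (0, 1, 0) (oneSubSq (0, 0, 1) (oneSubSq (0, 0, 1) f))))))
  refine ⟨C, hC0, fun s ξ η μ => ?_⟩
  have h := (hC s (ξ, η, μ)).trans (mul_le_of_le_one_right hC0.le (wt_le_one s))
  simp only [FT3_oneSubSq, norm_mul, Complex.norm_real, dot3, one_mul, zero_mul, add_zero,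
    zero_add] at h
  have h1 : ∀ x : ℝ, ‖1 + x ^ 2‖ = (wt x)⁻¹ := fun x => by
    rw [Real.norm_of_nonneg (by positivity), wt, inv_inv]
  simp only [h1] at h
  have := wt_pos ξ; have := wt_pos η; have := wt_pos μ
  calc ‖FT3 (fun w => f (s, w)) (ξ, η, μ)‖ = ((wt ξ)⁻¹ * ((wt ξ)⁻¹ * ((wt η)⁻¹ * ((wt η)⁻¹ *
        ((wt μ)⁻¹ * ((wt μ)⁻¹ * ‖FT3 (fun w => f (s, w)) (ξ, η, μ)‖)))))) *
        (wt ξ ^ 2 * wt η ^ 2 * wt μ ^ 2) := by field_simp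
    _ ≤ _ := by gcongr

lemma dot3_self_mul_wt_le (ξ η μ : ℝ) :
    dot3 (ξ, η, μ) (ξ, η, μ) * (wt ξ ^ 2 * wt η ^ 2 * wt μ ^ 2) ≤ wt ξ * wt η * wt μ := by
  have := wt_pos ξ; have := wt_pos η; have := wt_pos μ
  have h : dot3 (ξ, η, μ) (ξ, η, μ) ≤ (wt ξ)⁻¹ * (wt η)⁻¹ * (wt μ)⁻¹ := by
    simp only [dot3, wt, inv_inv]
    nlinarith [mul_nonneg (sq_nonneg ξ) (sq_nonneg η), mul_nonneg (sq_nonneg ξ) (sq_nonneg μ),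
      mul_nonneg (sq_nonneg η) (sq_nonneg μ),
      mul_nonneg (mul_nonneg (sq_nonneg ξ) (sq_nonneg η)) (sq_nonneg μ)]
  calc _ ≤ ((wt ξ)⁻¹ * (wt η)⁻¹ * (wt μ)⁻¹) * (wt ξ ^ 2 * wt η ^ 2 * wt μ ^ 2) := by gcongr
    _ = _ := by field_simp

lemma dot3_self_nonneg (ξ : ℝ × ℝ × ℝ) : 0 ≤ dot3 ξ ξ := by
  unfold dot3; nlinarith [mul_self_nonneg ξ.1, mul_self_nonneg ξ.2.1, mul_self_nonneg ξ.2.2]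

lemma exists_dot3_mul_FT3_decay (f : SchwartzMap (ℝ × ℝ × ℝ × ℝ) ℂ) :
    ∃ C : ℝ, 0 < C ∧ ∀ s ξ η μ,
      ‖((dot3 (ξ, η, μ) (ξ, η, μ) : ℝ) : ℂ) * FT3 (fun w => f (s, w)) (ξ, η, μ)‖ ≤
      C * (wt ξ * wt η * wt μ) := by
  obtain ⟨C, hC0, hC⟩ := exists_FT3_decay f
  refine ⟨C, hC0, fun s ξ η μ => ?_⟩
  rw [norm_mul, Complex.norm_real, Real.norm_of_nonneg (dot3_self_nonneg _)]
  calc _ ≤ dot3 (ξ, η, μ) (ξ, η, μ) * (C * (wt ξ ^ 2 * wt η ^ 2 * wt μ ^ 2)) := by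
        gcongr
        · exact dot3_self_nonneg _
        · exact hC s ξ η μ
    _ = C * (dot3 (ξ, η, μ) (ξ, η, μ) * (wt ξ ^ 2 * wt η ^ 2 * wt μ ^ 2)) := by ring
    _ ≤ _ := mul_le_mul_of_nonneg_left (dot3_self_mul_wt_le ξ η μ) hC0.le

lemma continuous_FT3_slice (f : SchwartzMap (ℝ × ℝ × ℝ × ℝ) ℂ) :
    Continuous fun p : ℝ × ℝ × ℝ × ℝ => FT3 (fun w => f (p.1, w)) p.2 := by
  obtain ⟨C, hC0, hC⟩ := exists_schwartz_decay f
  simp only [FT3_eq_osc]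
  refine continuous_const.mul (continuous_of_dominated (bound := fun p : ℝ × ℝ × ℝ =>
    C * (wt p.1 * (wt p.2.1 * wt p.2.2))) (fun p => ?_) (fun p => .of_forall fun x => ?_)
    (integrable_wt3 C) (.of_forall fun x => ?_))
  · refine Continuous.aestronglyMeasurable ?_
    unfold dot3
    have := f.continuous
    fun_prop
  · rw [norm_mul, norm_osc, one_mul]
    have := wt_pos x.1; have := wt_pos x.2.1; have := wt_pos x.2.2
    calc _ ≤ C * wt p.1 * wt x.1 * wt x.2.1 * wt x.2.2 := hC _ _ _ _
      _ = C * (wt x.1 * (wt x.2.1 * wt x.2.2)) * wt p.1 := by ring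
      _ ≤ _ := mul_le_of_le_one_right (by positivity) (wt_le_one _)
  · unfold dot3
    have := f.continuous
    fun_prop

/-- The partial Fourier integral in the last two variables. -/
def partialFT (f : ℝ × ℝ × ℝ × ℝ → ℂ) (s x η μ : ℝ) : ℂ :=
  ∫ y, osc (-1 * y * η) * ∫ z, osc (-1 * z * μ) * f (s, x, y, z)

lemma partialFT_eq_prod (f : SchwartzMap (ℝ × ℝ × ℝ × ℝ) ℂ) (s x η μ : ℝ) :
    partialFT f s x η μ = ∫ p : ℝ × ℝ, osc (-(p.1 * η + p.2 * μ)) * f (s, x, p.1, p.2) := by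
  obtain ⟨C, hC0, hC⟩ := exists_schwartz_decay f
  have hi : Integrable fun p : ℝ × ℝ => f (s, x, p.1, p.2) := by
    refine ((integrable_wt.mul_prod integrable_wt).const_mul (C * wt s * wt x)).mono'
      (f.continuous.comp (by fun_prop)).aestronglyMeasurable (.of_forall fun p => ?_)
    exact (hC s x p.1 p.2).trans (le_of_eq (by ring))
  rw [Measure.volume_eq_prod, integral_prod _ (by
    rw [← Measure.volume_eq_prod]
    exact integrable_osc_mul hi (by fun_prop)), partialFT]
  refine integral_congr_ae (.of_forall fun y => ?_)
  simp only
  rw [← integral_const_mul]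
  refine integral_congr_ae (.of_forall fun z => ?_)
  simp only
  rw [← mul_assoc, ← osc_add]
  ring_nf

lemma exists_partialFT_le (f : SchwartzMap (ℝ × ℝ × ℝ × ℝ) ℂ) :
    ∃ C : ℝ, 0 < C ∧ ∀ s x η μ, ‖partialFT f s x η μ‖ ≤ C * wt x := by
  obtain ⟨C, hC0, hC⟩ := exists_schwartz_decay f
  set J := ∫ p : ℝ × ℝ, wt p.1 * wt p.2 with hJ
  have hJ0 : 0 ≤ J := integral_nonneg fun p => by
    have := wt_pos p.1; have := wt_pos p.2; positivity
  refine ⟨C * J + 1, by positivity, fun s x η μ => ?_⟩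
  have := wt_pos x
  have h : ‖partialFT f s x η μ‖ ≤ C * wt x * J := by
    rw [partialFT_eq_prod, hJ, ← integral_const_mul]
    refine norm_integral_le_of_norm_le ((integrable_wt.mul_prod integrable_wt).const_mul _)
      (.of_forall fun p => ?_)
    rw [norm_mul, norm_osc, one_mul]
    have := wt_pos p.1; have := wt_pos p.2
    calc _ ≤ C * wt s * wt x * wt p.1 * wt p.2 := hC _ _ _ _
      _ = C * wt x * (wt p.1 * wt p.2) * wt s := by ring
      _ ≤ _ := mul_le_of_le_one_right (by positivity) (wt_le_one _)
  nlinarith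

lemma continuous_partialFT (f : SchwartzMap (ℝ × ℝ × ℝ × ℝ) ℂ) :
    Continuous fun p : ℝ × ℝ × ℝ × ℝ => partialFT f p.1 p.2.1 p.2.2.1 p.2.2.2 := by
  obtain ⟨C, hC0, hC⟩ := exists_schwartz_decay f
  simp only [partialFT_eq_prod]
  refine continuous_of_dominated (bound := fun p : ℝ × ℝ => C * (wt p.1 * wt p.2))
    (fun p => ?_) (fun p => .of_forall fun x => ?_)
    ((integrable_wt.mul_prod integrable_wt).const_mul C) (.of_forall fun x => ?_)
  · refine Continuous.aestronglyMeasurable ?_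
    have := f.continuous
    fun_prop
  · rw [norm_mul, norm_osc, one_mul]
    have := wt_pos x.1; have := wt_pos x.2; have := wt_pos p.1; have := wt_pos p.2.1
    calc _ ≤ C * wt p.1 * wt p.2.1 * wt x.1 * wt x.2 := hC _ _ _ _
      _ = C * (wt x.1 * wt x.2) * (wt p.1 * wt p.2.1) := by ring
      _ ≤ _ := mul_le_of_le_one_right (by positivity)
        (mul_le_one₀ (wt_le_one _) (wt_pos _).le (wt_le_one _))
  · have := f.continuous
    fun_prop

lemma FT3_eq_integral_partialFT (f : SchwartzMap (ℝ × ℝ × ℝ × ℝ) ℂ) (s ξ η μ : ℝ) :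
    FT3 (fun w => f (s, w)) (ξ, η, μ) =
      ((((2 * π) ^ 3)⁻¹ : ℝ) : ℂ) * ∫ x, osc (-(ξ * x)) * partialFT f s x η μ := by
  rw [FT3_eq_osc]
  congr 1
  have hm : Measurable fun x : ℝ × ℝ × ℝ => -dot3 x (ξ, η, μ) := by unfold dot3; fun_prop
  rw [Measure.volume_eq_prod, integral_prod _ (by
    rw [← Measure.volume_eq_prod]; exact integrable_osc_mul (integrable_slice f s) hm)]
  refine integral_congr_ae (.of_forall fun x => ?_)
  simp only
  rw [partialFT_eq_prod, ← integral_const_mul]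
  refine integral_congr_ae (.of_forall fun p => ?_)
  simp only
  rw [← mul_assoc, ← osc_add]
  simp only [dot3]
  ring_nf

lemma lintegral_enorm_sq_osc_osc_le {g : ℝ → ℝ → ℂ}
    (hg : StronglyMeasurable (Function.uncurry g)) {a b : ℝ} (ha : a ≠ 0) (hb : b ≠ 0) :
    ∫⁻ y, ∫⁻ z, ‖∫ η, osc (a * y * η) * ∫ μ, osc (b * z * μ) * g η μ‖ₑ ^ 2 ≤
      ENNReal.ofReal (2 * π / |a|) * ENNReal.ofReal (2 * π / |b|) *
        ∫⁻ η, ∫⁻ μ, ‖g η μ‖ₑ ^ 2 := by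
  have hG : StronglyMeasurable fun p : ℝ × ℝ => ∫ μ, osc (b * p.1 * μ) * g p.2 μ := by
    refine StronglyMeasurable.integral_prod_right' (f := fun q : (ℝ × ℝ) × ℝ =>
      osc (b * q.1.1 * q.2) * g q.1.2 q.2) ?_
    refine StronglyMeasurable.mul (Continuous.stronglyMeasurable (by fun_prop)) ?_
    exact hg.comp_measurable (g := fun q : (ℝ × ℝ) × ℝ => (q.1.2, q.2)) (by fun_prop)
  have hH : StronglyMeasurable fun p : ℝ × ℝ =>
      ∫ η, osc (a * p.1 * η) * ∫ μ, osc (b * p.2 * μ) * g η μ := by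
    refine StronglyMeasurable.integral_prod_right' (f := fun q : (ℝ × ℝ) × ℝ =>
      osc (a * q.1.1 * q.2) * ∫ μ, osc (b * q.1.2 * μ) * g q.2 μ) ?_
    refine StronglyMeasurable.mul (Continuous.stronglyMeasurable (by fun_prop)) ?_
    exact hG.comp_measurable (g := fun q : (ℝ × ℝ) × ℝ => (q.1.2, q.2)) (by fun_prop)
  rw [lintegral_lintegral_swap (by
    exact (hH.measurable.enorm.pow_const 2).aemeasurable)]
  calc _ ≤ ∫⁻ z, ENNReal.ofReal (2 * π / |a|) *
        ∫⁻ η, ‖∫ μ, osc (b * z * μ) * g η μ‖ₑ ^ 2 :=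
        lintegral_mono fun z => lintegral_enorm_sq_osc_le _ ha
    _ = ENNReal.ofReal (2 * π / |a|) *
        ∫⁻ η, ∫⁻ z, ‖∫ μ, osc (b * z * μ) * g η μ‖ₑ ^ 2 := by
        rw [lintegral_const_mul' _ _ ENNReal.ofReal_ne_top, lintegral_lintegral_swap (by
          exact (hG.measurable.enorm.pow_const 2).aemeasurable)]
    _ ≤ ENNReal.ofReal (2 * π / |a|) *
        ∫⁻ η, ENNReal.ofReal (2 * π / |b|) * ∫⁻ μ, ‖g η μ‖ₑ ^ 2 := by
        gcongr with η
        exact lintegral_enorm_sq_osc_le _ hb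
    _ = _ := by
        rw [lintegral_const_mul' _ _ ENNReal.ofReal_ne_top, mul_assoc]

/-- Minkowski's integral inequality in `L²`. -/
lemma lintegral_sq_lintegral_le {α : Type*} [MeasurableSpace α] {ν : Measure α} [SFinite ν]
    {φ : α → ℝ → ℝ≥0∞} (hφ : Measurable (Function.uncurry φ)) :
    ∫⁻ p, (∫⁻ x, φ p x) ^ 2 ∂ν ≤ (∫⁻ x, (∫⁻ p, φ p x ^ 2 ∂ν) ^ (1 / 2 : ℝ)) ^ 2 := by
  have hx : ∀ x, Measurable fun p => φ p x := fun x => hφ.of_uncurry_right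
  have hp : ∀ p, Measurable fun x => φ p x := fun p => hφ.of_uncurry_left
  have hN : Measurable fun x => (∫⁻ p, φ p x ^ 2 ∂ν) ^ (1 / 2 : ℝ) := by
    refine Measurable.pow_const ?_ _
    exact Measurable.lintegral_prod_left' (f := fun q : α × ℝ => φ q.1 q.2 ^ 2)
      (hφ.pow_const 2)
  calc ∫⁻ p, (∫⁻ x, φ p x) ^ 2 ∂ν
      = ∫⁻ p, (∫⁻ x, φ p x * (∫⁻ x', φ p x')) ∂ν := by
        refine lintegral_congr fun p => ?_
        rw [lintegral_mul_const _ (hp p), sq]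
    _ = ∫⁻ x, (∫⁻ p, φ p x * (∫⁻ x', φ p x') ∂ν) := by
        refine lintegral_lintegral_swap (Measurable.aemeasurable ?_)
        refine hφ.mul ?_
        exact (Measurable.lintegral_prod_right' (f := fun q : α × ℝ => φ q.1 q.2) hφ).comp
          measurable_fst
    _ = ∫⁻ x, ∫⁻ x', ∫⁻ p, φ p x * φ p x' ∂ν := by
        refine lintegral_congr fun x => ?_
        rw [← lintegral_lintegral_swap (Measurable.aemeasurable (by
          exact ((hx x).comp measurable_fst).mul hφ))]
        refine lintegral_congr fun p => ?_
        rw [lintegral_const_mul _ (hp p)]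
    _ ≤ ∫⁻ x, ∫⁻ x', (∫⁻ p, φ p x ^ 2 ∂ν) ^ (1 / 2 : ℝ) *
          (∫⁻ p, φ p x' ^ 2 ∂ν) ^ (1 / 2 : ℝ) := by
        gcongr with x x'
        have := ENNReal.lintegral_mul_le_Lp_mul_Lq ν (Real.HolderConjugate.two_two)
          (hx x).aemeasurable (hx x').aemeasurable
        simpa using this
    _ = _ := by
        simp only [lintegral_const_mul _ hN]
        rw [lintegral_mul_const _ hN, sq]

/-- The Fourier integral in time of the slice at `x`, cut off to `(0, T]` with an exponential
weight, after the partial Fourier integral in the last two variables. -/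
def timeFT (f : ℝ × ℝ × ℝ × ℝ → ℂ) (T η μ τ x : ℝ) : ℂ :=
  ∫ s, osc (-1 * τ * s) * (Set.Ioc 0 T).indicator
    (fun s => (Real.exp (-(1 / T * s)) : ℂ) * partialFT f s x η μ) s

lemma lintegral_enorm_sq_partialFT_le (f : SchwartzMap (ℝ × ℝ × ℝ × ℝ) ℂ) (s x : ℝ) :
    ∫⁻ η, ∫⁻ μ, ‖partialFT f s x η μ‖ₑ ^ 2 ≤
      ENNReal.ofReal (2 * π) ^ 2 * ∫⁻ y, ∫⁻ z, ‖f (s, x, y, z)‖ₑ ^ 2 := by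
  have h := lintegral_enorm_sq_osc_osc_le (g := fun y z => f (s, x, y, z))
    (f.continuous.comp (by fun_prop)).stronglyMeasurable (a := -1) (b := -1)
    (by norm_num) (by norm_num)
  simp only [abs_neg, abs_one, div_one] at h
  rw [← sq] at h
  refine le_trans (le_of_eq ?_) h
  refine lintegral_congr fun η => lintegral_congr fun μ => ?_
  rw [partialFT]
  congr 2
  refine integral_congr_ae (.of_forall fun y => ?_)
  simp only
  rw [show -1 * y * η = -1 * η * y by ring]
  congr 1
  refine integral_congr_ae (.of_forall fun z => ?_)
  simp only
  rw [show -1 * z * μ = -1 * μ * z by ring]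

lemma lintegral_enorm_sq_timeFT_le (f : SchwartzMap (ℝ × ℝ × ℝ × ℝ) ℂ) {T : ℝ} (hT : 0 < T)
    (x : ℝ) :
    ∫⁻ η, ∫⁻ μ, ∫⁻ τ, ‖timeFT f T η μ τ x‖ₑ ^ 2 ≤
      ENNReal.ofReal (2 * π) ^ 3 *
        ∫⁻ s in Set.Ioc 0 T, ∫⁻ y, ∫⁻ z, ‖f (s, x, y, z)‖ₑ ^ 2 := by
  have hP := continuous_partialFT f
  have hm : Measurable fun p : ℝ × ℝ × ℝ => ‖partialFT f p.1 x p.2.1 p.2.2‖ₑ ^ 2 := by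
    refine Measurable.pow_const (Measurable.enorm ?_) 2
    exact (hP.comp (g := fun p : ℝ × ℝ × ℝ × ℝ => partialFT f p.1 p.2.1 p.2.2.1 p.2.2.2)
      (f := fun p : ℝ × ℝ × ℝ => (p.1, x, p.2.1, p.2.2)) (by fun_prop)).measurable
  have h1 : ∀ η μ, ∫⁻ τ, ‖timeFT f T η μ τ x‖ₑ ^ 2 ≤
      ENNReal.ofReal (2 * π) * ∫⁻ s in Set.Ioc 0 T, ‖partialFT f s x η μ‖ₑ ^ 2 := fun η μ => by
    refine (lintegral_enorm_sq_osc_le _ (by norm_num)).trans ?_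
    rw [abs_neg, abs_one, div_one, ← lintegral_indicator measurableSet_Ioc]
    gcongr with s
    by_cases hs : s ∈ Set.Ioc 0 T
    · simp only [Set.indicator_of_mem hs]
      gcongr
      rw [enorm_mul]
      refine mul_le_of_le_one_left' ?_
      rw [← ofReal_norm, Complex.norm_real, Real.norm_of_nonneg (Real.exp_pos _).le]
      refine ENNReal.ofReal_le_one.2 (Real.exp_le_one_iff.2 ?_)
      have := hs.1
      have : 0 ≤ 1 / T * s := by positivity
      linarith
    · simp [Set.indicator_of_notMem hs]
  calc _ ≤ ∫⁻ η, ∫⁻ μ, ENNReal.ofReal (2 * π) *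
        ∫⁻ s in Set.Ioc 0 T, ‖partialFT f s x η μ‖ₑ ^ 2 := by
        gcongr with η μ; exact h1 η μ
    _ = ENNReal.ofReal (2 * π) * ∫⁻ η, ∫⁻ μ,
        ∫⁻ s in Set.Ioc 0 T, ‖partialFT f s x η μ‖ₑ ^ 2 := by
        simp only [lintegral_const_mul' _ _ ENNReal.ofReal_ne_top]
    _ = ENNReal.ofReal (2 * π) * ∫⁻ η, ∫⁻ s in Set.Ioc 0 T,
        ∫⁻ μ, ‖partialFT f s x η μ‖ₑ ^ 2 := by
        congr 1
        refine lintegral_congr fun η => ?_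
        refine lintegral_lintegral_swap (Measurable.aemeasurable ?_)
        exact hm.comp (g := fun p : ℝ × ℝ × ℝ => ‖partialFT f p.1 x p.2.1 p.2.2‖ₑ ^ 2)
          (f := fun q : ℝ × ℝ => (q.2, η, q.1)) (by fun_prop)
    _ = ENNReal.ofReal (2 * π) * ∫⁻ s in Set.Ioc 0 T, ∫⁻ η,
        ∫⁻ μ, ‖partialFT f s x η μ‖ₑ ^ 2 := by
        congr 1
        refine lintegral_lintegral_swap (Measurable.aemeasurable ?_)
        refine Measurable.lintegral_prod_right' (f := fun q : (ℝ × ℝ) × ℝ =>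
          ‖partialFT f q.1.2 x q.1.1 q.2‖ₑ ^ 2) ?_
        exact hm.comp (g := fun p : ℝ × ℝ × ℝ => ‖partialFT f p.1 x p.2.1 p.2.2‖ₑ ^ 2)
          (f := fun q : (ℝ × ℝ) × ℝ => (q.1.2, q.1.1, q.2)) (by fun_prop)
    _ ≤ ENNReal.ofReal (2 * π) * ∫⁻ s in Set.Ioc 0 T, ENNReal.ofReal (2 * π) ^ 2 *
        ∫⁻ y, ∫⁻ z, ‖f (s, x, y, z)‖ₑ ^ 2 := by
        gcongr with s
        exact lintegral_enorm_sq_partialFT_le f s x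
    _ = _ := by
        rw [lintegral_const_mul' _ _ (ENNReal.pow_ne_top ENNReal.ofReal_ne_top)]
        ring

/-- The frequency-side source term: the symbol `|ξ̄|²` times the spatial Fourier transform. -/
def amp (f : ℝ × ℝ × ℝ × ℝ → ℂ) (s ξ η μ : ℝ) : ℂ :=
  ((dot3 (ξ, η, μ) (ξ, η, μ) : ℝ) : ℂ) * FT3 (fun w => f (s, w)) (ξ, η, μ)

lemma continuous_amp (f : SchwartzMap (ℝ × ℝ × ℝ × ℝ) ℂ) :
    Continuous fun p : ℝ × ℝ × ℝ × ℝ => amp f p.1 p.2.1 p.2.2.1 p.2.2.2 := by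
  unfold amp
  refine Continuous.mul ?_ (continuous_FT3_slice f)
  unfold dot3
  fun_prop

lemma continuous_amp_comp (f : SchwartzMap (ℝ × ℝ × ℝ × ℝ) ℂ) {α : Type*} [TopologicalSpace α]
    {a b c d : α → ℝ} (ha : Continuous a) (hb : Continuous b) (hc : Continuous c)
    (hd : Continuous d) : Continuous fun p => amp f (a p) (b p) (c p) (d p) :=
  (continuous_amp f).comp (f := fun p => (a p, b p, c p, d p)) (by fun_prop)

lemma continuous_FT3_comp (f : SchwartzMap (ℝ × ℝ × ℝ × ℝ) ℂ) {α : Type*} [TopologicalSpace α]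
    {a b c d : α → ℝ} (ha : Continuous a) (hb : Continuous b) (hc : Continuous c)
    (hd : Continuous d) :
    Continuous fun p => FT3 (fun w => f (a p, w)) (b p, c p, d p) :=
  (continuous_FT3_slice f).comp (f := fun p => (a p, b p, c p, d p)) (by fun_prop)

lemma continuous_partialFT_comp (f : SchwartzMap (ℝ × ℝ × ℝ × ℝ) ℂ) {α : Type*}
    [TopologicalSpace α] {a b c d : α → ℝ} (ha : Continuous a) (hb : Continuous b)
    (hc : Continuous c) (hd : Continuous d) :
    Continuous fun p => partialFT f (a p) (b p) (c p) (d p) :=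
  (continuous_partialFT f).comp (f := fun p => (a p, b p, c p, d p)) (by fun_prop)

/-- The indicator of `(0, T]` with an exponential weight. -/
def cutoff (T s : ℝ) : ℂ := (Set.Ioc 0 T).indicator (fun s => (Real.exp (-(1 / T * s)) : ℂ)) s

lemma measurable_cutoff (T : ℝ) : Measurable (cutoff T) := by
  unfold cutoff
  exact (Continuous.measurable (by fun_prop)).indicator measurableSet_Ioc

lemma norm_cutoff_le {T : ℝ} (hT : 0 < T) (s : ℝ) :
    ‖cutoff T s‖ ≤ (Set.Ioc 0 T).indicator (fun _ => (1 : ℝ)) s := by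
  unfold cutoff
  by_cases hs : s ∈ Set.Ioc 0 T
  · simp only [Set.indicator_of_mem hs]
    rw [Complex.norm_real, Real.norm_of_nonneg (Real.exp_pos _).le, Real.exp_le_one_iff]
    have := hs.1
    have : 0 ≤ 1 / T * s := by positivity
    linarith
  · simp [Set.indicator_of_notMem hs]

lemma integrable_indicator_one (T : ℝ) :
    Integrable ((Set.Ioc 0 T).indicator (fun _ => (1 : ℝ))) :=
  (integrable_indicator_iff measurableSet_Ioc).2 (by simp)

lemma indicator_one_nonneg (T s : ℝ) : 0 ≤ (Set.Ioc 0 T).indicator (fun _ => (1 : ℝ)) s :=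
  Set.indicator_nonneg (fun _ _ => zero_le_one) _

lemma timeFT_eq (f : ℝ × ℝ × ℝ × ℝ → ℂ) (T η μ τ x : ℝ) :
    timeFT f T η μ τ x = ∫ s, osc (-1 * τ * s) * (cutoff T s * partialFT f s x η μ) := by
  unfold timeFT cutoff
  refine integral_congr_ae (.of_forall fun s => ?_)
  by_cases hs : s ∈ Set.Ioc 0 T <;> simp [hs]

lemma exists_timeFT_le (f : SchwartzMap (ℝ × ℝ × ℝ × ℝ) ℂ) {T : ℝ} (hT : 0 < T) :
    ∃ C : ℝ, 0 < C ∧ ∀ η μ τ x, ‖timeFT f T η μ τ x‖ ≤ C * wt x := by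
  obtain ⟨C, hC0, hC⟩ := exists_partialFT_le f
  set J := ∫ s, (Set.Ioc 0 T).indicator (fun _ => (1 : ℝ)) s with hJ
  have hJ0 : 0 ≤ J := integral_nonneg (indicator_one_nonneg T)
  refine ⟨C * J + 1, by positivity, fun η μ τ x => ?_⟩
  have := wt_pos x
  have h : ‖timeFT f T η μ τ x‖ ≤ C * wt x * J := by
    rw [timeFT_eq, hJ, ← integral_const_mul]
    refine norm_integral_le_of_norm_le ((integrable_indicator_one T).const_mul _)
      (.of_forall fun s => ?_)
    rw [norm_mul, norm_osc, one_mul, norm_mul, mul_comm]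
    exact mul_le_mul (hC _ _ _ _) (norm_cutoff_le hT s) (norm_nonneg _) (by positivity)
  nlinarith

lemma continuous_timeFT (f : SchwartzMap (ℝ × ℝ × ℝ × ℝ) ℂ) {T : ℝ} (hT : 0 < T) :
    Continuous fun p : ℝ × ℝ × ℝ × ℝ => timeFT f T p.1 p.2.1 p.2.2.1 p.2.2.2 := by
  obtain ⟨C, hC0, hC⟩ := exists_partialFT_le f
  simp only [timeFT_eq]
  refine continuous_of_dominated
    (bound := fun s => C * (Set.Ioc 0 T).indicator (fun _ => (1 : ℝ)) s)
    (fun p => ?_) (fun p => .of_forall fun s => ?_)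
    ((integrable_indicator_one T).const_mul C) (.of_forall fun s => ?_)
  · refine AEStronglyMeasurable.mul (Continuous.aestronglyMeasurable (by fun_prop)) ?_
    refine (measurable_cutoff T).aestronglyMeasurable.mul (Continuous.aestronglyMeasurable ?_)
    exact continuous_partialFT_comp f (by fun_prop) (by fun_prop) (by fun_prop) (by fun_prop)
  · rw [norm_mul, norm_osc, one_mul, norm_mul, mul_comm]
    refine mul_le_mul ((hC _ _ _ _).trans ?_) (norm_cutoff_le hT s) (norm_nonneg _) hC0.le
    exact mul_le_of_le_one_right hC0.le (wt_le_one _)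
  · refine Continuous.mul (by fun_prop) (continuous_const.mul ?_)
    exact continuous_partialFT_comp f (by fun_prop) (by fun_prop) (by fun_prop) (by fun_prop)

lemma continuous_timeFT_comp (f : SchwartzMap (ℝ × ℝ × ℝ × ℝ) ℂ) {T : ℝ} (hT : 0 < T)
    {α : Type*} [TopologicalSpace α] {a b c d : α → ℝ} (ha : Continuous a) (hb : Continuous b)
    (hc : Continuous c) (hd : Continuous d) :
    Continuous fun p => timeFT f T (a p) (b p) (c p) (d p) :=
  (continuous_timeFT f hT).comp (f := fun p => (a p, b p, c p, d p)) (by fun_prop)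

/-- Fubini: the time integral of the spatial Fourier transform is the Fourier integral in `x` of
`timeFT`. -/
lemma integral_cutoff_FT3 (f : SchwartzMap (ℝ × ℝ × ℝ × ℝ) ℂ) {T : ℝ} (hT : 0 < T)
    (η μ τ ξ : ℝ) :
    ∫ s, osc (-1 * τ * s) * (cutoff T s * FT3 (fun w => f (s, w)) (ξ, η, μ)) =
      ((((2 * π) ^ 3)⁻¹ : ℝ) : ℂ) * ∫ x, osc (-(ξ * x)) * timeFT f T η μ τ x := by
  obtain ⟨C, hC0, hC⟩ := exists_partialFT_le f
  have hi : Integrable (Function.uncurry fun s x : ℝ =>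
      osc (-1 * τ * s) * cutoff T s * (osc (-(ξ * x)) * partialFT f s x η μ)) := by
    refine (((integrable_indicator_one T).mul_prod integrable_wt).const_mul C).mono' ?_
      (.of_forall fun p => ?_)
    · refine AEStronglyMeasurable.mul (Measurable.aestronglyMeasurable ?_)
        (Continuous.aestronglyMeasurable ?_)
      · exact (Continuous.measurable (by fun_prop)).mul ((measurable_cutoff T).comp measurable_fst)
      · refine Continuous.mul (by fun_prop) ?_
        exact continuous_partialFT_comp f (by fun_prop) (by fun_prop) (by fun_prop) (by fun_prop)
    · simp only [Function.uncurry, norm_mul, norm_osc, one_mul]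
      calc _ ≤ (Set.Ioc 0 T).indicator (fun _ => (1 : ℝ)) p.1 * (C * wt p.2) :=
            mul_le_mul (norm_cutoff_le hT _) (hC _ _ _ _) (norm_nonneg _)
              (indicator_one_nonneg _ _)
        _ = _ := by ring
  calc _ = ∫ s, ((((2 * π) ^ 3)⁻¹ : ℝ) : ℂ) * ∫ x,
        osc (-1 * τ * s) * cutoff T s * (osc (-(ξ * x)) * partialFT f s x η μ) := by
        refine integral_congr_ae (.of_forall fun s => ?_)
        simp only
        rw [FT3_eq_integral_partialFT, integral_const_mul]
        ring
    _ = ((((2 * π) ^ 3)⁻¹ : ℝ) : ℂ) * ∫ x, ∫ s,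
        osc (-1 * τ * s) * cutoff T s * (osc (-(ξ * x)) * partialFT f s x η μ) := by
        rw [integral_const_mul, integral_integral_swap hi]
    _ = _ := by
        congr 1
        refine integral_congr_ae (.of_forall fun x => ?_)
        simp only
        rw [timeFT_eq, ← integral_const_mul]
        refine integral_congr_ae (.of_forall fun s => ?_)
        simp only
        ring

lemma integrable_timeFT (f : SchwartzMap (ℝ × ℝ × ℝ × ℝ) ℂ) {T : ℝ} (hT : 0 < T) (η μ τ : ℝ) :
    Integrable (timeFT f T η μ τ) := by
  obtain ⟨C, hC0, hC⟩ := exists_timeFT_le f hT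
  exact (integrable_wt.const_mul C).mono' (continuous_timeFT_comp f hT (by fun_prop)
    (by fun_prop) (by fun_prop) continuous_id).aestronglyMeasurable (.of_forall fun x => hC _ _ _ _)

lemma integrable_fourier_timeFT (f : SchwartzMap (ℝ × ℝ × ℝ × ℝ) ℂ) {T : ℝ} (hT : 0 < T)
    (η μ τ : ℝ) :
    Integrable fun ξ => ∫ x, osc (-(ξ * x)) * timeFT f T η μ τ x := by
  obtain ⟨C, hC0, hC⟩ := exists_FT3_decay f
  have h : ∀ ξ, ∫ x, osc (-(ξ * x)) * timeFT f T η μ τ x = (((2 * π) ^ 3 : ℝ) : ℂ) *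
      ∫ s, osc (-1 * τ * s) * (cutoff T s * FT3 (fun w => f (s, w)) (ξ, η, μ)) := fun ξ => by
    rw [integral_cutoff_FT3 f hT, ← mul_assoc, ← Complex.ofReal_mul, mul_inv_cancel₀ (by positivity)]
    simp
  simp only [h]
  refine Integrable.const_mul ?_ _
  set J := ∫ s, (Set.Ioc 0 T).indicator (fun _ => (1 : ℝ)) s with hJ
  have hJ0 : 0 ≤ J := integral_nonneg (indicator_one_nonneg T)
  refine (integrable_wt.const_mul (C * J)).mono' ?_ (.of_forall fun ξ => ?_)
  · refine StronglyMeasurable.aestronglyMeasurable ?_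
    refine StronglyMeasurable.integral_prod_right' (f := fun q : ℝ × ℝ =>
      osc (-1 * τ * q.2) * (cutoff T q.2 * FT3 (fun w => f (q.2, w)) (q.1, η, μ))) ?_
    refine StronglyMeasurable.mul (Continuous.stronglyMeasurable (by fun_prop)) ?_
    refine ((measurable_cutoff T).comp measurable_snd).stronglyMeasurable.mul
      (Continuous.stronglyMeasurable ?_)
    exact continuous_FT3_comp f (by fun_prop) (by fun_prop) (by fun_prop) (by fun_prop)
  · have := wt_pos ξ
    have : C * J * wt ξ = ∫ s, C * wt ξ * (Set.Ioc 0 T).indicator (fun _ => (1 : ℝ)) s := by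
      rw [integral_const_mul, ← hJ]; ring
    rw [this]
    refine norm_integral_le_of_norm_le ((integrable_indicator_one T).const_mul _)
      (.of_forall fun s => ?_)
    rw [norm_mul, norm_osc, one_mul, norm_mul, mul_comm]
    refine mul_le_mul ((hC _ _ _ _).trans ?_) (norm_cutoff_le hT s) (norm_nonneg _) (by positivity)
    have h1 := wt_le_one ξ; have h2 := wt_le_one η; have h3 := wt_le_one μ
    have := wt_pos η; have := wt_pos μ
    gcongr
    calc wt ξ ^ 2 * wt η ^ 2 * wt μ ^ 2 ≤ wt ξ ^ 2 * 1 ^ 2 * 1 ^ 2 := by gcongr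
      _ = wt ξ * wt ξ := by ring
      _ ≤ wt ξ := mul_le_of_le_one_right (by positivity) h1

lemma exists_amp_le (f : SchwartzMap (ℝ × ℝ × ℝ × ℝ) ℂ) :
    ∃ C : ℝ, 0 < C ∧ ∀ s ξ η μ, ‖amp f s ξ η μ‖ ≤ C * (wt ξ * wt η * wt μ) :=
  exists_dot3_mul_FT3_decay f

lemma exists_amp_le_wt (f : SchwartzMap (ℝ × ℝ × ℝ × ℝ) ℂ) :
    ∃ C : ℝ, 0 < C ∧ ∀ s ξ η μ, ‖amp f s ξ η μ‖ ≤ C * wt ξ := by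
  obtain ⟨C, hC0, hC⟩ := exists_amp_le f
  refine ⟨C, hC0, fun s ξ η μ => (hC s ξ η μ).trans ?_⟩
  have := wt_pos ξ; have := wt_pos η; have := wt_pos μ
  calc C * (wt ξ * wt η * wt μ) ≤ C * (wt ξ * 1 * 1) := by
        gcongr <;> exact wt_le_one _
    _ = _ := by ring

/-- The Duhamel term after the Fourier transform in the last two variables. -/
def freqDuhamel (f : ℝ × ℝ × ℝ × ℝ → ℂ) (t x η μ : ℝ) : ℂ :=
  ∫ ξ, ∫ s in Set.Ioc 0 t, osc (x * ξ) *
    (osc ((t - s) * (ξ * (ξ ^ 2 + (η ^ 2 + μ ^ 2)))) * amp f s ξ η μ)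

open Classical in
/-- The exponentially damped retarded integrand, with the source restricted to `(0, T]`. -/
def dampedKernel (f : ℝ × ℝ × ℝ × ℝ → ℂ) (T x η μ t ξ s : ℝ) : ℂ :=
  if s ∈ Set.Ioc 0 T ∧ s ≤ t then (Real.exp (-(1 / T * t)) : ℂ) * (osc (x * ξ) *
    (osc ((t - s) * (ξ * (ξ ^ 2 + (η ^ 2 + μ ^ 2)))) * amp f s ξ η μ)) else 0

lemma stronglyMeasurable_dampedKernel (f : SchwartzMap (ℝ × ℝ × ℝ × ℝ) ℂ) (T x η μ : ℝ) :
    StronglyMeasurable fun q : ℝ × ℝ × ℝ => dampedKernel f T x η μ q.1 q.2.1 q.2.2 := by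
  unfold dampedKernel
  refine StronglyMeasurable.ite ?_ (Continuous.stronglyMeasurable ?_) stronglyMeasurable_const
  · refine MeasurableSet.inter ?_ ?_
    · exact (measurable_snd.comp measurable_snd) measurableSet_Ioc
    · exact measurableSet_le (measurable_snd.comp measurable_snd) measurable_fst
  · have := continuous_amp_comp f (α := ℝ × ℝ × ℝ) (a := fun q => q.2.2) (b := fun q => q.2.1)
      (c := fun _ => η) (d := fun _ => μ) (by fun_prop) (by fun_prop) (by fun_prop) (by fun_prop)
    fun_prop

/-- The integrable decaying exponential on the half line. -/
def expTail (T t : ℝ) : ℝ := (Set.Ioi 0).indicator (fun t => Real.exp (-(1 / T) * t)) t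

lemma integrable_expTail {T : ℝ} (hT : 0 < T) : Integrable (expTail T) := by
  unfold expTail
  exact (integrable_indicator_iff measurableSet_Ioi).2 (exp_neg_integrableOn_Ioi 0 (by positivity))

lemma expTail_nonneg (T t : ℝ) : 0 ≤ expTail T t :=
  Set.indicator_nonneg (fun _ _ => (Real.exp_pos _).le) _

lemma expTail_le_one {T : ℝ} (hT : 0 < T) (t : ℝ) : expTail T t ≤ 1 := by
  refine Set.indicator_le' (fun t ht => ?_) (fun _ _ => zero_le_one) t
  rw [Real.exp_le_one_iff]
  have : 0 < t := ht
  have : 0 < 1 / T * t := by positivity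
  linarith

lemma exists_dampedKernel_le (f : SchwartzMap (ℝ × ℝ × ℝ × ℝ) ℂ) :
    ∃ C : ℝ, 0 < C ∧ ∀ T x η μ t ξ s, ‖dampedKernel f T x η μ t ξ s‖ ≤
      expTail T t * (C * (wt ξ * (Set.Ioc 0 T).indicator (fun _ => (1 : ℝ)) s)) := by
  obtain ⟨C, hC0, hC⟩ := exists_amp_le_wt f
  refine ⟨C, hC0, fun T x η μ t ξ s => ?_⟩
  have := wt_pos ξ
  unfold dampedKernel
  split_ifs with h
  · rw [Set.indicator_of_mem h.1, mul_one, norm_mul, norm_mul, norm_mul, norm_osc, norm_osc,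
      one_mul, one_mul, expTail, Set.indicator_of_mem (show t ∈ Set.Ioi 0 from h.1.1.trans_le h.2),
      Complex.norm_real, Real.norm_of_nonneg (Real.exp_pos _).le, neg_mul]
    gcongr
    exact hC _ _ _ _
  · rw [norm_zero]
    have := expTail_nonneg T t
    have := indicator_one_nonneg T s
    positivity

lemma integrable_dampedKernel (f : SchwartzMap (ℝ × ℝ × ℝ × ℝ) ℂ) {T : ℝ} (hT : 0 < T)
    (x η μ : ℝ) :
    Integrable fun q : ℝ × ℝ × ℝ => dampedKernel f T x η μ q.1 q.2.1 q.2.2 := by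
  obtain ⟨C, hC0, hC⟩ := exists_dampedKernel_le f
  exact ((integrable_expTail hT).mul_prod ((integrable_wt.mul_prod
    (integrable_indicator_one T)).const_mul C)).mono'
    (stronglyMeasurable_dampedKernel f T x η μ).aestronglyMeasurable (.of_forall fun q => hC ..)

lemma integrable_dampedKernel_slice (f : SchwartzMap (ℝ × ℝ × ℝ × ℝ) ℂ) (T x η μ t : ℝ) :
    Integrable fun q : ℝ × ℝ => dampedKernel f T x η μ t q.1 q.2 := by
  obtain ⟨C, hC0, hC⟩ := exists_dampedKernel_le f
  exact (((integrable_wt.mul_prod (integrable_indicator_one T)).const_mul C).const_mul _).mono'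
    ((stronglyMeasurable_dampedKernel f T x η μ).comp_measurable
      (g := fun q : ℝ × ℝ => (t, q.1, q.2)) (by fun_prop)).aestronglyMeasurable
    (.of_forall fun q => hC ..)

/-- The damped Duhamel term on the whole time line. -/
def dampedDuhamel (f : ℝ × ℝ × ℝ × ℝ → ℂ) (T x η μ t : ℝ) : ℂ :=
  ∫ q : ℝ × ℝ, dampedKernel f T x η μ t q.1 q.2

lemma freqDuhamel_eq (f : SchwartzMap (ℝ × ℝ × ℝ × ℝ) ℂ) {T x η μ t : ℝ}
    (ht : t ∈ Set.Ioc 0 T) :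
    freqDuhamel f t x η μ = (Real.exp (1 / T * t) : ℂ) * dampedDuhamel f T x η μ t := by
  have hi := integrable_dampedKernel_slice f T x η μ t
  rw [dampedDuhamel, freqDuhamel, Measure.volume_eq_prod, integral_prod _ hi, ← integral_const_mul]
  refine integral_congr_ae (.of_forall fun ξ => ?_)
  simp only
  rw [← integral_const_mul, ← integral_indicator measurableSet_Ioc]
  refine integral_congr_ae (.of_forall fun s => ?_)
  simp only [dampedKernel]
  by_cases hs : s ∈ Set.Ioc 0 t
  · rw [Set.indicator_of_mem hs, if_pos ⟨⟨hs.1, hs.2.trans ht.2⟩, hs.2⟩, ← mul_assoc (Real.exp (1 / T * t) : ℂ),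
      ← Complex.ofReal_mul, ← Real.exp_add]
    simp
  · rw [Set.indicator_of_notMem hs, if_neg fun h => hs ⟨h.1.1, h.2⟩, mul_zero]

lemma stronglyMeasurable_dampedDuhamel (f : SchwartzMap (ℝ × ℝ × ℝ × ℝ) ℂ) (T x η μ : ℝ) :
    StronglyMeasurable (dampedDuhamel f T x η μ) := by
  unfold dampedDuhamel
  exact StronglyMeasurable.integral_prod_right'
    (f := fun q : ℝ × ℝ × ℝ => dampedKernel f T x η μ q.1 q.2.1 q.2.2)
    (stronglyMeasurable_dampedKernel f T x η μ)

lemma exists_dampedDuhamel_le (f : SchwartzMap (ℝ × ℝ × ℝ × ℝ) ℂ) (T : ℝ) :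
    ∃ C : ℝ, 0 ≤ C ∧ ∀ x η μ t, ‖dampedDuhamel f T x η μ t‖ ≤ C * expTail T t := by
  obtain ⟨C, hC0, hC⟩ := exists_dampedKernel_le f
  refine ⟨∫ q : ℝ × ℝ, C * (wt q.1 * (Set.Ioc 0 T).indicator (fun _ => (1 : ℝ)) q.2),
    integral_nonneg fun q => ?_, fun x η μ t => ?_⟩
  · have := wt_pos q.1; have := indicator_one_nonneg T q.2
    positivity
  · rw [mul_comm, ← integral_const_mul]
    exact norm_integral_le_of_norm_le (((integrable_wt.mul_prod
      (integrable_indicator_one T)).const_mul C).const_mul _) (.of_forall fun q => hC ..)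

lemma integrable_dampedDuhamel (f : SchwartzMap (ℝ × ℝ × ℝ × ℝ) ℂ) {T : ℝ} (hT : 0 < T)
    (x η μ : ℝ) : Integrable (dampedDuhamel f T x η μ) := by
  obtain ⟨C, hC0, hC⟩ := exists_dampedDuhamel_le f T
  exact ((integrable_expTail hT).const_mul C).mono'
    (stronglyMeasurable_dampedDuhamel f T x η μ).aestronglyMeasurable (.of_forall fun t => hC ..)

lemma memLp_dampedDuhamel (f : SchwartzMap (ℝ × ℝ × ℝ × ℝ) ℂ) {T : ℝ} (hT : 0 < T)
    (x η μ : ℝ) : MemLp (dampedDuhamel f T x η μ) 2 := by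
  obtain ⟨C, hC0, hC⟩ := exists_dampedDuhamel_le f T
  rw [memLp_two_iff_integrable_sq_norm
    (stronglyMeasurable_dampedDuhamel f T x η μ).aestronglyMeasurable]
  refine ((integrable_expTail hT).const_mul (C ^ 2)).mono'
    ((stronglyMeasurable_dampedDuhamel f T x η μ).norm.pow 2).aestronglyMeasurable
    (.of_forall fun t => ?_)
  rw [Real.norm_of_nonneg (by positivity)]
  have h0 := expTail_nonneg T t
  calc ‖dampedDuhamel f T x η μ t‖ ^ 2 ≤ (C * expTail T t) ^ 2 := by gcongr; exact hC ..
    _ = C ^ 2 * expTail T t * expTail T t := by ring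
    _ ≤ _ := mul_le_of_le_one_right (by positivity) (expTail_le_one hT t)

lemma integral_osc_dampedKernel (f : ℝ × ℝ × ℝ × ℝ → ℂ) {T : ℝ} (hT : 0 < T)
    (x η μ τ ξ s : ℝ) :
    ∫ t, osc (-1 * τ * t) * dampedKernel f T x η μ t ξ s =
      osc (x * ξ) * (resolventSymbol (1 / T) τ (η ^ 2 + μ ^ 2) ξ *
        (osc (-1 * τ * s) * (cutoff T s * FT3 (fun w => f (s, w)) (ξ, η, μ)))) := by
  set ω := ξ * (ξ ^ 2 + (η ^ 2 + μ ^ 2)) with hω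
  by_cases hs : s ∈ Set.Ioc 0 T
  · set l : ℂ := -((1 / T : ℝ) + τ * Complex.I - Complex.I * (ω : ℂ)) with hl
    have hre : l.re < 0 := by
      have : 0 < 1 / T := by positivity
      simp only [hl]
      simp
      simpa using this
    have hl0 : l ≠ 0 := fun h => by simp [h] at hre
    have h1 : ∀ t, osc (-1 * τ * t) * dampedKernel f T x η μ t ξ s =
        (Set.Ici s).indicator (fun t : ℝ => osc (x * ξ) * (osc (-(s * ω)) * amp f s ξ η μ) *
          Complex.exp (l * t)) t := fun t => by
      unfold dampedKernel
      by_cases hst : s ≤ t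
      · rw [if_pos ⟨hs, hst⟩, Set.indicator_of_mem (show t ∈ Set.Ici s from hst)]
        have : Complex.exp (l * t) = (Real.exp (-(1 / T * t)) : ℂ) * (osc (-1 * τ * t) *
            osc (t * ω)) := by
          rw [Complex.ofReal_exp, osc, osc, ← Complex.exp_add, ← Complex.exp_add, hl]
          congr 1
          push_cast; ring
        rw [this, show (t - s) * ω = t * ω + -(s * ω) by ring, osc_add]
        ring
      · rw [if_neg fun h => hst h.2, Set.indicator_of_notMem (show t ∉ Set.Ici s from hst),
          mul_zero]
    simp only [h1]
    rw [integral_indicator measurableSet_Ici, integral_const_mul, integral_Ici_eq_integral_Ioi,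
      integral_exp_mul_complex_Ioi hre]
    have h2 : Complex.exp (l * s) = (Real.exp (-(1 / T * s)) : ℂ) * (osc (-1 * τ * s) *
        osc (s * ω)) := by
      rw [Complex.ofReal_exp, osc, osc, ← Complex.exp_add, ← Complex.exp_add, hl]
      congr 1
      push_cast; ring
    have h3 : osc (-(s * ω)) * osc (s * ω) = 1 := by
      rw [← osc_add]; simp [osc]
    have h4 : (1 / T : ℝ) + τ * Complex.I - Complex.I * (ω : ℂ) = -l := by rw [hl, neg_neg]
    rw [h2, resolventSymbol, cutoff, Set.indicator_of_mem hs, amp, h4]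
    have h5 : dot3 (ξ, η, μ) (ξ, η, μ) = ξ ^ 2 + (η ^ 2 + μ ^ 2) := by simp only [dot3]; ring
    rw [h5]
    generalize FT3 _ _ = F at *
    field_simp
    linear_combination (-(((ξ ^ 2 + (η ^ 2 + μ ^ 2) : ℝ) : ℂ)) * osc (x * ξ) * F *
      osc (-(s * τ))) * h3
  · have h1 : ∀ t, dampedKernel f T x η μ t ξ s = 0 := fun t => if_neg fun h => hs h.1
    simp [h1, cutoff, Set.indicator_of_notMem hs]

lemma fourier_dampedDuhamel (f : SchwartzMap (ℝ × ℝ × ℝ × ℝ) ℂ) {T : ℝ} (hT : 0 < T)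
    (x η μ τ : ℝ) :
    ∫ t, osc (-1 * τ * t) * dampedDuhamel f T x η μ t =
      ((((2 * π) ^ 3)⁻¹ : ℝ) : ℂ) * ∫ ξ, osc (x * ξ) *
        (resolventSymbol (1 / T) τ (η ^ 2 + μ ^ 2) ξ *
          ∫ x', osc (-(ξ * x')) * timeFT f T η μ τ x') := by
  have hi : Integrable (Function.uncurry fun (t : ℝ) (q : ℝ × ℝ) =>
      osc (-1 * τ * t) * dampedKernel f T x η μ t q.1 q.2) :=
    integrable_osc_mul (integrable_dampedKernel f hT x η μ) (by fun_prop)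
  have hi' := hi.integral_prod_right
  simp only [Function.uncurry, integral_osc_dampedKernel _ hT] at hi'
  calc _ = ∫ t, ∫ q : ℝ × ℝ, osc (-1 * τ * t) * dampedKernel f T x η μ t q.1 q.2 := by
        simp only [dampedDuhamel, integral_const_mul]
    _ = ∫ q : ℝ × ℝ, ∫ t, osc (-1 * τ * t) * dampedKernel f T x η μ t q.1 q.2 :=
        integral_integral_swap hi
    _ = ∫ ξ, ∫ s, osc (x * ξ) * (resolventSymbol (1 / T) τ (η ^ 2 + μ ^ 2) ξ *
        (osc (-1 * τ * s) * (cutoff T s * FT3 (fun w => f (s, w)) (ξ, η, μ)))) := by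
        simp only [integral_osc_dampedKernel _ hT]
        rw [Measure.volume_eq_prod]
        exact integral_prod (fun q : ℝ × ℝ => osc (x * q.1) *
          (resolventSymbol (1 / T) τ (η ^ 2 + μ ^ 2) q.1 *
          (osc (-1 * τ * q.2) * (cutoff T q.2 * FT3 (fun w => f (q.2, w)) (q.1, η, μ))))) hi'
    _ = _ := by
        rw [← integral_const_mul ((((2 * π) ^ 3)⁻¹ : ℝ) : ℂ)]
        refine integral_congr_ae (.of_forall fun ξ => ?_)
        simp only
        rw [integral_const_mul, integral_const_mul, integral_cutoff_FT3 f hT]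
        ring

lemma enorm_fourier_dampedDuhamel_le (f : SchwartzMap (ℝ × ℝ × ℝ × ℝ) ℂ) {T : ℝ} (hT : 0 < T)
    (x η μ : ℝ) {τ : ℝ} (hτ : τ ≠ 0) :
    ‖∫ t, osc (-1 * τ * t) * dampedDuhamel f T x η μ t‖ₑ ≤ ∫⁻ x', ‖timeFT f T η μ τ x'‖ₑ := by
  have hc : Continuous (timeFT f T η μ τ) :=
    continuous_timeFT_comp f hT (by fun_prop) (by fun_prop) (by fun_prop) continuous_id
  have hi := integrable_timeFT f hT η μ τ
  have h := norm_integral_resolventSymbol_le (ε := 1 / T) (ρ := η ^ 2 + μ ^ 2) (by positivity) hτ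
    (by positivity) hc hi (integrable_fourier_timeFT f hT η μ τ) x
  rw [fourier_dampedDuhamel f hT, ← ofReal_norm, ← ofReal_integral_norm_eq_lintegral_enorm hi]
  refine ENNReal.ofReal_le_ofReal ?_
  rw [norm_mul, Complex.norm_real, Real.norm_of_nonneg (by positivity)]
  have hJ : 0 ≤ ∫ v, ‖timeFT f T η μ τ v‖ := integral_nonneg fun _ => norm_nonneg _
  calc _ ≤ ((2 * π) ^ 3)⁻¹ * (8 * π * ∫ v, ‖timeFT f T η μ τ v‖) := by gcongr
    _ = (π ^ 2)⁻¹ * ∫ v, ‖timeFT f T η μ τ v‖ := by field_simp; norm_num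
    _ ≤ _ := by
        refine mul_le_of_le_one_left hJ (inv_le_one_of_one_le₀ ?_)
        nlinarith [Real.pi_gt_three]

lemma lintegral_enorm_sq_freqDuhamel_le (f : SchwartzMap (ℝ × ℝ × ℝ × ℝ) ℂ) {T : ℝ} (hT : 0 < T)
    (x η μ : ℝ) :
    ∫⁻ t in Set.Ioc 0 T, ‖freqDuhamel f t x η μ‖ₑ ^ 2 ≤
      ENNReal.ofReal (Real.exp 1) ^ 2 * ∫⁻ τ, (∫⁻ x', ‖timeFT f T η μ τ x'‖ₑ) ^ 2 := by
  have h1 : ∀ t ∈ Set.Ioc 0 T, ‖freqDuhamel f t x η μ‖ₑ ^ 2 ≤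
      ENNReal.ofReal (Real.exp 1) ^ 2 * ‖dampedDuhamel f T x η μ t‖ₑ ^ 2 := fun t ht => by
    rw [freqDuhamel_eq f ht, enorm_mul, mul_pow]
    gcongr
    rw [← ofReal_norm, Complex.norm_real, Real.norm_of_nonneg (Real.exp_pos _).le]
    gcongr
    rw [one_div, inv_mul_le_one₀ hT]
    exact ht.2
  calc _ ≤ ∫⁻ t in Set.Ioc 0 T, ENNReal.ofReal (Real.exp 1) ^ 2 *
        ‖dampedDuhamel f T x η μ t‖ₑ ^ 2 := setLIntegral_mono' measurableSet_Ioc h1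
    _ ≤ ∫⁻ t, ENNReal.ofReal (Real.exp 1) ^ 2 * ‖dampedDuhamel f T x η μ t‖ₑ ^ 2 :=
        setLIntegral_le_lintegral _ _
    _ = ENNReal.ofReal (Real.exp 1) ^ 2 * ∫⁻ t, ‖dampedDuhamel f T x η μ t‖ₑ ^ 2 :=
        lintegral_const_mul' _ _ (ENNReal.pow_ne_top ENNReal.ofReal_ne_top)
    _ ≤ ENNReal.ofReal (Real.exp 1) ^ 2 *
        ∫⁻ τ, ‖∫ t, osc (-1 * τ * t) * dampedDuhamel f T x η μ t‖ₑ ^ 2 := by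
        refine mul_le_mul_right ?_ _
        rw [lintegral_enorm_sq_osc (integrable_dampedDuhamel f hT x η μ)
          (memLp_dampedDuhamel f hT x η μ) (by norm_num)]
        refine le_mul_of_one_le_left' ?_
        rw [abs_neg, abs_one, div_one, ENNReal.one_le_ofReal]
        linarith [Real.pi_gt_three]
    _ ≤ _ := by
        refine mul_le_mul_right (lintegral_mono_ae ?_) _
        have : ∀ᵐ τ : ℝ, τ ≠ 0 := by simp [ae_iff]
        filter_upwards [this] with τ hτ
        gcongr
        exact enorm_fourier_dampedDuhamel_le f hT x η μ hτ

lemma lintegral_lintegral_enorm_sq_freqDuhamel_le (f : SchwartzMap (ℝ × ℝ × ℝ × ℝ) ℂ) {T : ℝ}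
    (hT : 0 < T) (x : ℝ) :
    ∫⁻ η, ∫⁻ μ, ∫⁻ t in Set.Ioc 0 T, ‖freqDuhamel f t x η μ‖ₑ ^ 2 ≤
      (ENNReal.ofReal (Real.exp 1 * (2 * π) ^ 2) * ∫⁻ x',
        (∫⁻ s in Set.Ioc 0 T, ∫⁻ y, ∫⁻ z, ‖f (s, x', y, z)‖ₑ ^ 2) ^ (1 / 2 : ℝ)) ^ 2 := by
  have hm : Measurable fun q : (ℝ × ℝ × ℝ) × ℝ => ‖timeFT f T q.1.1 q.1.2.1 q.1.2.2 q.2‖ₑ :=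
    (continuous_timeFT_comp f hT (by fun_prop) (by fun_prop) (by fun_prop)
      (by fun_prop)).measurable.enorm
  have hprod : ∀ F : ℝ × ℝ × ℝ → ℝ≥0∞, Measurable F →
      ∫⁻ p, F p = ∫⁻ η, ∫⁻ μ, ∫⁻ τ, F (η, μ, τ) := fun F hF => by
    rw [Measure.volume_eq_prod, lintegral_prod _ hF.aemeasurable]
    refine lintegral_congr fun η => ?_
    exact lintegral_prod (fun q : ℝ × ℝ => F (η, q))
      (hF.comp (f := fun q : ℝ × ℝ => (η, q)) (by fun_prop)).aemeasurable
  calc _ ≤ ∫⁻ η, ∫⁻ μ, ENNReal.ofReal (Real.exp 1) ^ 2 *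
        ∫⁻ τ, (∫⁻ x', ‖timeFT f T η μ τ x'‖ₑ) ^ 2 := by
        gcongr with η μ
        exact lintegral_enorm_sq_freqDuhamel_le f hT x η μ
    _ = ENNReal.ofReal (Real.exp 1) ^ 2 *
        ∫⁻ η, ∫⁻ μ, ∫⁻ τ, (∫⁻ x', ‖timeFT f T η μ τ x'‖ₑ) ^ 2 := by
        simp only [lintegral_const_mul' _ _ (ENNReal.pow_ne_top ENNReal.ofReal_ne_top)]
    _ = ENNReal.ofReal (Real.exp 1) ^ 2 *
        ∫⁻ p : ℝ × ℝ × ℝ, (∫⁻ x', ‖timeFT f T p.1 p.2.1 p.2.2 x'‖ₑ) ^ 2 := by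
        rw [hprod]
        exact (Measurable.lintegral_prod_right' hm).pow_const 2
    _ ≤ ENNReal.ofReal (Real.exp 1) ^ 2 * (∫⁻ x', (∫⁻ p : ℝ × ℝ × ℝ,
        ‖timeFT f T p.1 p.2.1 p.2.2 x'‖ₑ ^ 2) ^ (1 / 2 : ℝ)) ^ 2 := by
        gcongr
        exact lintegral_sq_lintegral_le
          (φ := fun (p : ℝ × ℝ × ℝ) x' => ‖timeFT f T p.1 p.2.1 p.2.2 x'‖ₑ) hm
    _ ≤ ENNReal.ofReal (Real.exp 1) ^ 2 * (∫⁻ x', ENNReal.ofReal ((2 * π) ^ 2) *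
        (∫⁻ s in Set.Ioc 0 T, ∫⁻ y, ∫⁻ z, ‖f (s, x', y, z)‖ₑ ^ 2) ^ (1 / 2 : ℝ)) ^ 2 := by
        gcongr with x'
        rw [hprod (fun p => ‖timeFT f T p.1 p.2.1 p.2.2 x'‖ₑ ^ 2)
          (Measurable.pow_const (Measurable.of_uncurry_right
            (f := fun (p : ℝ × ℝ × ℝ) x' => ‖timeFT f T p.1 p.2.1 p.2.2 x'‖ₑ) hm) 2)]
        have h2 : (1 : ℝ≥0∞) ≤ ENNReal.ofReal (2 * π) := by
          rw [ENNReal.one_le_ofReal]; linarith [Real.pi_gt_three]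
        calc _ ≤ ((ENNReal.ofReal ((2 * π) ^ 2)) ^ (2 : ℝ) *
              ∫⁻ s in Set.Ioc 0 T, ∫⁻ y, ∫⁻ z, ‖f (s, x', y, z)‖ₑ ^ 2) ^ (1 / 2 : ℝ) := by
              gcongr
              refine (lintegral_enorm_sq_timeFT_le f hT x').trans ?_
              gcongr
              rw [ENNReal.ofReal_pow (by positivity), ENNReal.rpow_two, ← pow_mul]
              exact pow_le_pow_right₀ h2 (by norm_num)
          _ = _ := by
              rw [ENNReal.mul_rpow_of_nonneg _ _ (by norm_num), ← ENNReal.rpow_mul]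
              norm_num
    _ = _ := by
        rw [lintegral_const_mul' _ _ ENNReal.ofReal_ne_top, ← mul_pow, ← mul_assoc,
          ENNReal.ofReal_mul (Real.exp_pos _).le]

lemma duhamel_eq (f : SchwartzMap (ℝ × ℝ × ℝ × ℝ) ℂ) {t : ℝ} (ht : 0 ≤ t) (x y z : ℝ) :
    duhamel (fun ξ => ((dot3 ξ ξ : ℝ) : ℂ)) f t (x, y, z) =
      ∫ η, osc (1 * y * η) * ∫ μ, osc (1 * z * μ) * freqDuhamel f t x η μ := by
  obtain ⟨C, hC0, hC⟩ := exists_amp_le f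
  let Φ : ℝ → ℝ × ℝ × ℝ → ℂ := fun s ξ => osc (y * ξ.2.1) * (osc (z * ξ.2.2) * (osc (x * ξ.1) *
    (osc ((t - s) * (ξ.1 * (ξ.1 ^ 2 + (ξ.2.1 ^ 2 + ξ.2.2 ^ 2)))) * amp f s ξ.1 ξ.2.1 ξ.2.2)))
  have hi : Integrable (Function.uncurry Φ)
      ((volume.restrict (Set.Ioc 0 t)).prod (volume : Measure (ℝ × ℝ × ℝ))) := by
    refine ((integrable_const (μ := volume.restrict (Set.Ioc 0 t)) (1 : ℝ)).mul_prod
      (integrable_wt3 C)).mono' (Continuous.aestronglyMeasurable ?_) (.of_forall fun q => ?_)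
    · have := continuous_amp_comp f (α := ℝ × ℝ × ℝ × ℝ) (a := fun q => q.1)
        (b := fun q => q.2.1) (c := fun q => q.2.2.1) (d := fun q => q.2.2.2)
        (by fun_prop) (by fun_prop) (by fun_prop) (by fun_prop)
      simp only [Φ]
      fun_prop
    · simp only [Function.uncurry, Φ, norm_mul, norm_osc, one_mul]
      refine (hC _ _ _ _).trans (le_of_eq (by ring))
  have hG := hi.integral_prod_right
  simp only [Function.uncurry] at hG
  calc _ = ∫ s in Set.Ioc 0 t, ∫ ξ, Φ s ξ := by
        rw [duhamel, intervalIntegral.integral_of_le ht]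
        refine integral_congr_ae (.of_forall fun s => ?_)
        refine integral_congr_ae (.of_forall fun ξ => ?_)
        simp only [Φ, amp, ← mul_assoc, ← osc_add]
        simp only [osc, dot3, omega3]
        congr 4
        push_cast; ring
    _ = ∫ ξ, ∫ s in Set.Ioc 0 t, Φ s ξ := integral_integral_swap hi
    _ = ∫ ξ, ∫ p : ℝ × ℝ, ∫ s in Set.Ioc 0 t, Φ s (ξ, p) := by
        exact integral_prod _ hG
    _ = ∫ p : ℝ × ℝ, ∫ ξ, ∫ s in Set.Ioc 0 t, Φ s (ξ, p) :=
        integral_integral_swap hG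
    _ = ∫ η, ∫ μ, ∫ ξ, ∫ s in Set.Ioc 0 t, Φ s (ξ, η, μ) := by
        exact integral_prod _ (Integrable.integral_prod_right hG)
    _ = _ := by
        refine integral_congr_ae (.of_forall fun η => ?_)
        simp only [Φ, integral_const_mul, freqDuhamel, one_mul]

lemma stronglyMeasurable_freqDuhamel (f : SchwartzMap (ℝ × ℝ × ℝ × ℝ) ℂ) (x : ℝ) :
    StronglyMeasurable fun q : ℝ × ℝ × ℝ => freqDuhamel f q.1 x q.2.1 q.2.2 := by
  classical
  have h : ∀ q : ℝ × ℝ × ℝ, freqDuhamel f q.1 x q.2.1 q.2.2 = ∫ ξ, ∫ s,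
      if 0 < s ∧ s ≤ q.1 then osc (x * ξ) * (osc ((q.1 - s) * (ξ * (ξ ^ 2 +
        (q.2.1 ^ 2 + q.2.2 ^ 2)))) * amp f s ξ q.2.1 q.2.2) else 0 := fun q => by
    unfold freqDuhamel
    refine integral_congr_ae (.of_forall fun ξ => ?_)
    simp only
    rw [← integral_indicator measurableSet_Ioc]
    refine integral_congr_ae (.of_forall fun s => ?_)
    simp only [Set.indicator, Set.mem_Ioc]
  simp only [h]
  refine StronglyMeasurable.integral_prod_right' (f := fun r : (ℝ × ℝ × ℝ) × ℝ => ∫ s,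
      if 0 < s ∧ s ≤ r.1.1 then osc (x * r.2) * (osc ((r.1.1 - s) * (r.2 * (r.2 ^ 2 +
        (r.1.2.1 ^ 2 + r.1.2.2 ^ 2)))) * amp f s r.2 r.1.2.1 r.1.2.2) else 0) ?_
  refine StronglyMeasurable.integral_prod_right' (f := fun r : ((ℝ × ℝ × ℝ) × ℝ) × ℝ =>
      if 0 < r.2 ∧ r.2 ≤ r.1.1.1 then osc (x * r.1.2) * (osc ((r.1.1.1 - r.2) * (r.1.2 *
        (r.1.2 ^ 2 + (r.1.1.2.1 ^ 2 + r.1.1.2.2 ^ 2)))) *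
        amp f r.2 r.1.2 r.1.1.2.1 r.1.1.2.2) else 0) ?_
  refine StronglyMeasurable.ite ?_ (Continuous.stronglyMeasurable ?_) stronglyMeasurable_const
  · exact (measurableSet_lt measurable_const measurable_snd).inter
      (measurableSet_le measurable_snd (measurable_fst.comp (measurable_fst.comp measurable_fst)))
  · have := continuous_amp_comp f (α := ((ℝ × ℝ × ℝ) × ℝ) × ℝ) (a := fun r => r.2)
      (b := fun r => r.1.2) (c := fun r => r.1.1.2.1) (d := fun r => r.1.1.2.2)
      (by fun_prop) (by fun_prop) (by fun_prop) (by fun_prop)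
    fun_prop

lemma lintegral_enorm_sq_duhamel_le (f : SchwartzMap (ℝ × ℝ × ℝ × ℝ) ℂ) {T : ℝ} (hT : 0 < T)
    (x : ℝ) :
    ∫⁻ t in Set.Ioc 0 T, ∫⁻ y, ∫⁻ z,
        ‖duhamel (fun ξ => ((dot3 ξ ξ : ℝ) : ℂ)) f t (x, y, z)‖ₑ ^ 2 ≤
      (ENNReal.ofReal (Real.exp 1 * (2 * π) ^ 3) * ∫⁻ x',
        (∫⁻ s in Set.Ioc 0 T, ∫⁻ y, ∫⁻ z, ‖f (s, x', y, z)‖ₑ ^ 2) ^ (1 / 2 : ℝ)) ^ 2 := by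
  have hN := stronglyMeasurable_freqDuhamel f x
  have hm : Measurable fun q : ℝ × ℝ × ℝ => ‖freqDuhamel f q.1 x q.2.1 q.2.2‖ₑ ^ 2 :=
    hN.measurable.enorm.pow_const 2
  calc _ ≤ ∫⁻ t in Set.Ioc 0 T, ENNReal.ofReal (2 * π) ^ 2 *
        ∫⁻ η, ∫⁻ μ, ‖freqDuhamel f t x η μ‖ₑ ^ 2 := by
        refine setLIntegral_mono' measurableSet_Ioc fun t ht => ?_
        simp only [duhamel_eq f ht.1.le]
        have h := lintegral_enorm_sq_osc_osc_le (g := fun η μ => freqDuhamel f t x η μ)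
          (hN.comp_measurable (g := fun q : ℝ × ℝ => (t, q.1, q.2)) (by fun_prop))
          one_ne_zero one_ne_zero
        rwa [abs_one, div_one, ← sq] at h
    _ = ENNReal.ofReal (2 * π) ^ 2 * ∫⁻ t in Set.Ioc 0 T,
        ∫⁻ η, ∫⁻ μ, ‖freqDuhamel f t x η μ‖ₑ ^ 2 :=
        lintegral_const_mul' _ _ (ENNReal.pow_ne_top ENNReal.ofReal_ne_top)
    _ = ENNReal.ofReal (2 * π) ^ 2 * ∫⁻ η, ∫⁻ t in Set.Ioc 0 T,
        ∫⁻ μ, ‖freqDuhamel f t x η μ‖ₑ ^ 2 := by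
        congr 1
        refine lintegral_lintegral_swap (Measurable.aemeasurable ?_)
        exact Measurable.lintegral_prod_right' (f := fun q : (ℝ × ℝ) × ℝ =>
          ‖freqDuhamel f q.1.1 x q.1.2 q.2‖ₑ ^ 2) (hm.comp
            (f := fun q : (ℝ × ℝ) × ℝ => (q.1.1, q.1.2, q.2)) (by fun_prop))
    _ = ENNReal.ofReal (2 * π) ^ 2 * ∫⁻ η, ∫⁻ μ, ∫⁻ t in Set.Ioc 0 T,
        ‖freqDuhamel f t x η μ‖ₑ ^ 2 := by
        congr 1
        refine lintegral_congr fun η => ?_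
        refine lintegral_lintegral_swap (Measurable.aemeasurable ?_)
        exact hm.comp (f := fun q : ℝ × ℝ => (q.1, η, q.2)) (by fun_prop)
    _ ≤ ENNReal.ofReal (2 * π) ^ 2 * (ENNReal.ofReal (Real.exp 1 * (2 * π) ^ 2) * ∫⁻ x',
        (∫⁻ s in Set.Ioc 0 T, ∫⁻ y, ∫⁻ z, ‖f (s, x', y, z)‖ₑ ^ 2) ^ (1 / 2 : ℝ)) ^ 2 :=
        mul_le_mul_right (lintegral_lintegral_enorm_sq_freqDuhamel_le f hT x) _
    _ = _ := by
        rw [← mul_pow, ← mul_assoc, ← ENNReal.ofReal_mul (by positivity),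
          show 2 * π * (Real.exp 1 * (2 * π) ^ 2) = Real.exp 1 * (2 * π) ^ 3 by ring]

lemma exists_norm_sq_le (f : SchwartzMap (ℝ × ℝ × ℝ × ℝ) ℂ) :
    ∃ C : ℝ, 0 < C ∧ ∀ s x y z,
      ‖f (s, x, y, z)‖ ^ 2 ≤ (C * wt x) ^ 2 * (wt s * (wt y * wt z)) := by
  obtain ⟨C, hC0, hC⟩ := exists_schwartz_decay f
  refine ⟨C, hC0, fun s x y z => ?_⟩
  have := wt_pos s; have := wt_pos x; have := wt_pos y; have := wt_pos z
  calc _ ≤ (C * wt s * wt x * wt y * wt z) ^ 2 := by gcongr; exact hC s x y z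
    _ = (C * wt x) ^ 2 * (wt s * (wt y * wt z)) * (wt s * (wt y * wt z)) := by ring
    _ ≤ _ := by
        refine mul_le_of_le_one_right (by positivity) ?_
        refine mul_le_one₀ (wt_le_one _) (by positivity) ?_
        exact mul_le_one₀ (wt_le_one _) (by positivity) (wt_le_one _)

lemma integrable_wt_restrict (T : ℝ) :
    Integrable (fun q : ℝ × ℝ × ℝ => wt q.1 * (wt q.2.1 * wt q.2.2))
      ((volume.restrict (Set.Ioc 0 T)).prod volume) :=
  integrable_wt.restrict.mul_prod (integrable_wt.mul_prod integrable_wt)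

lemma integrable_norm_sq_slice (f : SchwartzMap (ℝ × ℝ × ℝ × ℝ) ℂ) (T x : ℝ) :
    Integrable (fun q : ℝ × ℝ × ℝ => ‖f (q.1, x, q.2.1, q.2.2)‖ ^ 2)
      ((volume.restrict (Set.Ioc 0 T)).prod volume) := by
  obtain ⟨C, -, hC⟩ := exists_norm_sq_le f
  have := f.continuous
  refine ((integrable_wt_restrict T).const_mul ((C * wt x) ^ 2)).mono'
    (Continuous.aestronglyMeasurable (by fun_prop)) (.of_forall fun q => ?_)
  rw [Real.norm_of_nonneg (by positivity)]
  exact hC ..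

lemma integral_norm_sq_slice (f : SchwartzMap (ℝ × ℝ × ℝ × ℝ) ℂ) (T x : ℝ) :
    ∫ t in Set.Ioc 0 T, ∫ y, ∫ z, ‖f (t, x, y, z)‖ ^ 2 =
      ∫ q : ℝ × ℝ × ℝ, ‖f (q.1, x, q.2.1, q.2.2)‖ ^ 2
        ∂((volume.restrict (Set.Ioc 0 T)).prod volume) := by
  obtain ⟨C, -, hC⟩ := exists_norm_sq_le f
  have := f.continuous
  rw [integral_prod _ (integrable_norm_sq_slice f T x)]
  refine integral_congr_ae (.of_forall fun t => ?_)
  have hi : Integrable fun p : ℝ × ℝ => ‖f (t, x, p.1, p.2)‖ ^ 2 := by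
    refine (((integrable_wt.mul_prod integrable_wt).const_mul (wt t)).const_mul
      ((C * wt x) ^ 2)).mono' (Continuous.aestronglyMeasurable (by fun_prop))
      (.of_forall fun p => ?_)
    rw [Real.norm_of_nonneg (by positivity)]
    exact hC ..
  exact (integral_prod _ hi).symm

lemma lintegral_enorm_sq_slice (f : SchwartzMap (ℝ × ℝ × ℝ × ℝ) ℂ) (T x : ℝ) :
    ∫⁻ t in Set.Ioc 0 T, ∫⁻ y, ∫⁻ z, ‖f (t, x, y, z)‖ₑ ^ 2 =
      ENNReal.ofReal (∫ t in Set.Ioc 0 T, ∫ y, ∫ z, ‖f (t, x, y, z)‖ ^ 2) := by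
  have := f.continuous
  have hm : Measurable fun q : ℝ × ℝ × ℝ => ‖f (q.1, x, q.2.1, q.2.2)‖ₑ ^ 2 :=
    Measurable.pow_const (Continuous.measurable (by fun_prop)).enorm 2
  rw [integral_norm_sq_slice, ofReal_integral_eq_lintegral_ofReal (integrable_norm_sq_slice f T x)
    (.of_forall fun q => by positivity)]
  simp only [ENNReal.ofReal_pow (norm_nonneg _), ofReal_norm]
  rw [lintegral_prod _ hm.aemeasurable]
  refine lintegral_congr fun t => ?_
  exact (lintegral_prod (fun p : ℝ × ℝ => ‖f (t, x, p.1, p.2)‖ₑ ^ 2)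
    (hm.comp (f := fun p : ℝ × ℝ => (t, p.1, p.2)) (by fun_prop)).aemeasurable).symm

lemma integrable_sqrt_slice (f : SchwartzMap (ℝ × ℝ × ℝ × ℝ) ℂ) (T : ℝ) :
    Integrable fun x => Real.sqrt (∫ t in Set.Ioc 0 T, ∫ y, ∫ z, ‖f (t, x, y, z)‖ ^ 2) := by
  obtain ⟨C, hC0, hC⟩ := exists_norm_sq_le f
  have := f.continuous
  simp only [integral_norm_sq_slice]
  refine (integrable_wt.const_mul (Real.sqrt (∫ q : ℝ × ℝ × ℝ, wt q.1 * (wt q.2.1 * wt q.2.2)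
    ∂((volume.restrict (Set.Ioc 0 T)).prod volume)) * C)).mono' ?_ (.of_forall fun x => ?_)
  · refine (Real.continuous_sqrt.comp_stronglyMeasurable ?_).aestronglyMeasurable
    exact StronglyMeasurable.integral_prod_right' (f := fun r : ℝ × (ℝ × ℝ × ℝ) =>
      ‖f (r.2.1, r.1, r.2.2.1, r.2.2.2)‖ ^ 2) (Continuous.stronglyMeasurable (by fun_prop))
  · have := wt_pos x
    rw [Real.norm_of_nonneg (Real.sqrt_nonneg _), mul_assoc,
      ← Real.sqrt_sq (show 0 ≤ C * wt x by positivity), mul_comm,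
      ← Real.sqrt_mul (by positivity)]
    refine Real.sqrt_le_sqrt ?_
    rw [← integral_const_mul]
    exact integral_mono (integrable_norm_sq_slice f T x)
      ((integrable_wt_restrict T).const_mul _) fun q => hC ..

lemma ofReal_integral_norm_sq_le {g : ℝ → ℝ → ℝ → ℂ} (S : Set ℝ) :
    ENNReal.ofReal (∫ t in S, ∫ y, ∫ z, ‖g t y z‖ ^ 2) ≤
      ∫⁻ t in S, ∫⁻ y, ∫⁻ z, ‖g t y z‖ₑ ^ 2 := by
  refine (Real.ofReal_le_enorm _).trans ?_
  refine (enorm_integral_le_lintegral_enorm _).trans (lintegral_mono fun t => ?_)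
  refine (enorm_integral_le_lintegral_enorm _).trans (lintegral_mono fun y => ?_)
  refine (enorm_integral_le_lintegral_enorm _).trans (lintegral_mono fun z => ?_)
  rw [enorm_pow, enorm_norm]

end Duhamel

/-- Estimate (est-nhsmooth): ‖D²∫₀^t U(t-t')f(t')dt'‖_{L^∞_x L²_{yzT}} ≲ ‖f‖_{L¹_x L²_{yzT}},
where D² is the Fourier multiplier with symbol |ξ̄|². -/
theorem duhamel_D2_Linfx_L2 :
    ∃ C : ℝ, 0 < C ∧ ∀ T : ℝ, 0 < T → ∀ f : SchwartzMap (ℝ × ℝ × ℝ × ℝ) ℂ,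
      (⨆ x : ℝ,
        Real.sqrt (∫ t in Set.Ioc (0:ℝ) T, ∫ y : ℝ, ∫ z : ℝ,
          ‖duhamel (fun ξ => ((dot3 ξ ξ : ℝ) : ℂ)) (⇑f) t (x, y, z)‖ ^ 2))
      ≤ C * ∫ x : ℝ, Real.sqrt (∫ t in Set.Ioc (0:ℝ) T, ∫ y : ℝ, ∫ z : ℝ,
          ‖f (t, x, y, z)‖ ^ 2) := by
  refine ⟨Real.exp 1 * (2 * π) ^ 3, by positivity, fun T hT f => ciSup_le fun x => ?_⟩
  set R := ∫ x : ℝ, Real.sqrt (∫ t in Set.Ioc (0:ℝ) T, ∫ y : ℝ, ∫ z : ℝ,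
    ‖f (t, x, y, z)‖ ^ 2) with hR
  have hR0 : 0 ≤ R := integral_nonneg fun _ => Real.sqrt_nonneg _
  have hR' : ∫⁻ x, (∫⁻ s in Set.Ioc 0 T, ∫⁻ y, ∫⁻ z, ‖f (s, x, y, z)‖ₑ ^ 2) ^ (1 / 2 : ℝ) =
      ENNReal.ofReal R := by
    rw [hR, ofReal_integral_eq_lintegral_ofReal (integrable_sqrt_slice f T)
      (.of_forall fun _ => Real.sqrt_nonneg _)]
    refine lintegral_congr fun x => ?_
    rw [lintegral_enorm_sq_slice, Real.sqrt_eq_rpow, ENNReal.ofReal_rpow_of_nonneg _ (by norm_num)]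
    rw [integral_norm_sq_slice]
    exact integral_nonneg fun _ => by positivity
  have h := (ofReal_integral_norm_sq_le (Set.Ioc 0 T) (g := fun t y z =>
    duhamel (fun ξ => ((dot3 ξ ξ : ℝ) : ℂ)) f t (x, y, z))).trans
    (lintegral_enorm_sq_duhamel_le f hT x)
  rw [hR', ← ENNReal.ofReal_mul (by positivity), ← ENNReal.ofReal_pow (by positivity),
    ENNReal.ofReal_le_ofReal_iff (by positivity)] at h
  exact Real.sqrt_le_iff.2 ⟨by positivity, h⟩
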